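/- Let q be a prime power. The number of ordered 8-arcs in ℙ²(F_q) is C_8(q) = (q^2+q+1)(q^2+q)q^2(q-1)^2 · [ (q-5)(q^7 - 43q^6 + 788q^5 - 7937q^4 + 47097q^3 - 162834q^2 + 299280q - 222960) - 240(q^2 - 20q + 78)·a(q) + 840·b(q) ], where a(q) = 1 if q is even and 0 otherwise, and b(q) = #{x ∈ F_q : x² + x + 1 = 0}. -/

import Mathlib

/-- Three points of the Desarguesian projective plane `ℙ²(F)` are collinear
iff representative vectors are linearly dependent. -/
def P2Collinear (F : Type) [Field F]
    (x y z : Projectivization F (Fin 3 → F)) : Prop :=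
  ¬ Projectivization.Independent ![x, y, z]

/-- The number of ordered `n`-arcs of `ℙ²(F)`: `n`-tuples of distinct points,
no three collinear. -/
noncomputable def P2nArcs (F : Type) [Field F] (n : ℕ) : ℕ :=
  Nat.card {p : Fin n → Projectivization F (Fin 3 → F) // Function.Injective p ∧
    ∀ i j k : Fin n, i ≠ j → i ≠ k → j ≠ k → ¬ P2Collinear F (p i) (p j) (p k)}

namespace PlaneArcs

open Finset

section Matching

variable {ι : Type*} [Fintype ι] {R : ι → ι → Prop}

/-- A symmetric, irreflexive relation of degree at most one comes from an involution. -/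
lemma exists_involution (hirr : ∀ i, ¬ R i i) (hsymm : ∀ i j, R i j → R j i)
    (huniq : ∀ i j k, R i j → R i k → j = k) :
    ∃ τ : Equiv.Perm ι, τ ^ 2 = 1 ∧ ∀ i j, R i j ↔ τ i ≠ i ∧ τ i = j := by
  classical
  let g : ι → ι := fun i => if h : ∃ j, R i j then h.choose else i
  have hg : ∀ i j, R i j → g i = j := fun i j h => by
    have h' : ∃ j, R i j := ⟨j, h⟩
    simp only [g, dif_pos h']
    exact huniq _ _ _ h'.choose_spec h
  have hg' : ∀ i, (¬ ∃ j, R i j) → g i = i := fun i h => by simp only [g, dif_neg h]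
  have hinv : Function.Involutive g := fun i => by
    by_cases h : ∃ j, R i j
    · obtain ⟨j, h⟩ := h
      rw [hg i j h, hg j i (hsymm _ _ h)]
    · rw [hg' i h, hg' i h]
  refine ⟨hinv.toPerm, ?_, fun i j => ⟨fun h => ?_, fun ⟨h1, h2⟩ => ?_⟩⟩
  · ext i
    simp [pow_two, hinv i]
  · change g i ≠ i ∧ g i = j
    rw [hg i j h]
    refine ⟨?_, rfl⟩
    rintro rfl
    exact hirr _ h
  · change g i ≠ i at h1
    change g i = j at h2
    by_contra hn
    by_cases h : ∃ k, R i k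
    · obtain ⟨k, h⟩ := h
      rw [← h2, hg i k h] at hn
      exact hn h
    · exact h1 (hg' i h)

open Classical in
/-- The numbers of ordered tuples of one, two and three disjoint edges in a matching with
`k` edges. -/
lemma card_matching_tuples (hirr : ∀ i, ¬ R i i) (hsymm : ∀ i j, R i j → R j i)
    (huniq : ∀ i j k, R i j → R i k → j = k) :
    ∃ k : ℕ, 2 * k ≤ Fintype.card ι ∧ (k = 0 ↔ ∀ i j, ¬ R i j) ∧
      ((#{f : Fin 2 ↪ ι | R (f 0) (f 1)} : ℕ) : ℤ) = 2 * k ∧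
      ((#{f : Fin 4 ↪ ι | R (f 0) (f 1) ∧ R (f 2) (f 3)} : ℕ) : ℤ) = 2 * k * (2 * k - 2) ∧
      ((#{f : Fin 6 ↪ ι | R (f 0) (f 1) ∧ R (f 2) (f 3) ∧ R (f 4) (f 5)} : ℕ) : ℤ) =
        2 * k * (2 * k - 2) * (2 * k - 4) := by
  obtain ⟨τ, hτ, hR⟩ := exists_involution hirr hsymm huniq
  have hττ : ∀ i, τ (τ i) = i := fun i => by
    rw [← Equiv.Perm.mul_apply, ← pow_two, hτ, Equiv.Perm.one_apply]
  obtain ⟨k, hk⟩ := Equiv.Perm.two_dvd_card_support hτ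
  have hA : ∀ i, i ∈ τ.support ↔ τ i ≠ i := fun i => Equiv.Perm.mem_support
  have hA' : ∀ i, τ i ∈ τ.support ↔ i ∈ τ.support := fun i => Equiv.Perm.apply_mem_support
  have hinj : ∀ i j, τ i = τ j → i = j := fun i j h => τ.injective h
  have c2 : ∀ i ∈ τ.support, ((#(τ.support \ {i, τ i}) : ℕ) : ℤ) = 2 * k - 2 := by
    intro i hi
    have hs : ({i, τ i} : Finset ι) ⊆ τ.support := by
      intro x; simp only [mem_insert, mem_singleton]; rintro (rfl | rfl)
      · exact hi
      · exact (hA' _).2 hi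
    have := card_sdiff_add_card_eq_card hs
    rw [card_pair ((hA i).1 hi).symm, hk] at this
    omega
  have c4 : ∀ i ∈ τ.support, ∀ j ∈ τ.support \ {i, τ i},
      ((#(τ.support \ {i, τ i, j, τ j}) : ℕ) : ℤ) = 2 * k - 4 := by
    intro i hi j hj
    simp only [mem_sdiff, mem_insert, mem_singleton, not_or] at hj
    have hs : ({i, τ i, j, τ j} : Finset ι) ⊆ τ.support := by
      intro x; simp only [mem_insert, mem_singleton]; rintro (rfl | rfl | rfl | rfl)
      · exact hi
      · exact (hA' _).2 hi
      · exact hj.1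
      · exact (hA' _).2 hj.1
    have := card_sdiff_add_card_eq_card hs
    have h4 : #({i, τ i, j, τ j} : Finset ι) = 4 := by
      have h1 : i ≠ τ i := ((hA i).1 hi).symm
      have h2 : j ≠ τ j := ((hA j).1 hj.1).symm
      have h3 : i ≠ j := fun h => hj.2.1 h.symm
      have h4 : τ i ≠ j := fun h => hj.2.2 h.symm
      have h5 : i ≠ τ j := fun h => h4 (by rw [h, hττ])
      have h6 : τ i ≠ τ j := fun h => h3 (hinj _ _ h)
      rw [card_insert_of_notMem, card_insert_of_notMem, card_pair h2] <;>
        simp [*]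
    rw [h4, hk] at this
    omega
  refine ⟨k, ?_, ?_, ?_, ?_, ?_⟩
  · rw [← hk]; exact card_le_univ _
  · constructor
    · rintro rfl i j h
      have : τ.support = ∅ := by rw [← card_eq_zero, hk]
      have h2 := (hA i).2 ((hR i j).1 h).1
      rw [this] at h2
      simp at h2
    · intro h
      by_contra hne
      have : τ.support.Nonempty := by rw [← card_pos, hk]; omega
      obtain ⟨i, hi⟩ := this
      exact h i (τ i) ((hR _ _).2 ⟨(hA i).1 hi, rfl⟩)
  · have : #{f : Fin 2 ↪ ι | R (f 0) (f 1)} = #τ.support := by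
      refine card_bij (fun f _ => f 0) ?_ ?_ ?_
      · intro f hf
        simp only [mem_filter, mem_univ, true_and, hR] at hf
        exact (hA _).2 hf.1
      · intro f hf g hg h
        simp only [mem_filter, mem_univ, true_and, hR] at hf hg
        ext i
        fin_cases i
        · exact h
        · change f 1 = g 1
          rw [← hf.2, ← hg.2, h]
      · intro i hi
        have h1 := (hA i).1 hi
        refine ⟨⟨![i, τ i], ?_⟩, ?_, rfl⟩
        · intro a b; fin_cases a <;> fin_cases b <;> simp [h1, h1.symm]
        · simp only [mem_filter, mem_univ, true_and, hR]
          exact ⟨h1, rfl⟩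
    rw [this, hk]; push_cast; ring
  · have : #{f : Fin 4 ↪ ι | R (f 0) (f 1) ∧ R (f 2) (f 3)} =
        #(τ.support.sigma fun i => τ.support \ {i, τ i}) := by
      refine card_bij (fun f _ => ⟨f 0, f 2⟩) ?_ ?_ ?_
      · intro f hf
        simp only [mem_filter, mem_univ, true_and, hR] at hf
        obtain ⟨⟨h1, h2⟩, h3, h4⟩ := hf
        simp only [mem_sigma, mem_sdiff, mem_insert, mem_singleton, h2, hA, ne_eq, h4,
          EmbeddingLike.apply_eq_iff_eq]
        decide
      · intro f hf g hg h
        simp only [mem_filter, mem_univ, true_and, hR] at hf hg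
        simp only [Sigma.mk.injEq, heq_eq_eq] at h
        ext i
        fin_cases i
        · exact h.1
        · change f 1 = g 1
          rw [← hf.1.2, ← hg.1.2, h.1]
        · exact h.2
        · change f 3 = g 3
          rw [← hf.2.2, ← hg.2.2, h.2]
      · rintro ⟨i, j⟩ hij
        simp only [mem_sigma, mem_sdiff, mem_insert, mem_singleton, not_or, hA] at hij
        obtain ⟨h1, h2, h3, h4⟩ := hij
        have h5 : i ≠ τ j := fun h => h4 (by rw [h, hττ])
        have h6 : τ i ≠ τ j := fun h => h3 (hinj _ _ h).symm
        refine ⟨⟨![i, τ i, j, τ j], ?_⟩, ?_, rfl⟩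
        · intro a b
          fin_cases a <;> fin_cases b <;>
            simp [h1, Ne.symm h1, h2, Ne.symm h2, h3, Ne.symm h3, h4, Ne.symm h4, h5,
              Ne.symm h5, h6, Ne.symm h6]
        · simp only [mem_filter, mem_univ, true_and, hR]
          exact ⟨⟨h1, rfl⟩, h2, rfl⟩
    rw [this, card_sigma]
    push_cast
    rw [sum_congr rfl c2, sum_const, hk]
    simp
  · have : #{f : Fin 6 ↪ ι | R (f 0) (f 1) ∧ R (f 2) (f 3) ∧ R (f 4) (f 5)} =
        #(τ.support.sigma fun i => (τ.support \ {i, τ i}).sigma fun j =>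
          τ.support \ {i, τ i, j, τ j}) := by
      refine card_bij (fun f _ => ⟨f 0, f 2, f 4⟩) ?_ ?_ ?_
      · intro f hf
        simp only [mem_filter, mem_univ, true_and, hR] at hf
        obtain ⟨⟨h1, h2⟩, ⟨h3, h4⟩, h5, h6⟩ := hf
        simp only [mem_sigma, mem_sdiff, mem_insert, mem_singleton, h2, h4, hA, ne_eq, h6,
          EmbeddingLike.apply_eq_iff_eq]
        decide
      · intro f hf g hg h
        simp only [mem_filter, mem_univ, true_and, hR] at hf hg
        simp only [Sigma.mk.injEq] at h
        obtain ⟨h1, h2⟩ := h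
        have h2 := eq_of_heq h2
        simp only [Sigma.mk.injEq, heq_eq_eq] at h2
        ext i
        fin_cases i
        · exact h1
        · change f 1 = g 1
          rw [← hf.1.2, ← hg.1.2, h1]
        · exact h2.1
        · change f 3 = g 3
          rw [← hf.2.1.2, ← hg.2.1.2, h2.1]
        · exact h2.2
        · change f 5 = g 5
          rw [← hf.2.2.2, ← hg.2.2.2, h2.2]
      · rintro ⟨i, j, l⟩ hij
        simp only [mem_sigma, mem_sdiff, mem_insert, mem_singleton, not_or, hA] at hij
        obtain ⟨h1, ⟨h2, h3, h4⟩, h7, h8, h9, h10, h11⟩ := hij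
        have key : ∀ i j, j ≠ i → j ≠ τ i → i ≠ τ j ∧ τ i ≠ τ j := fun i j h h' =>
          ⟨fun e => h' (by rw [e, hττ]), fun e => h (hinj _ _ e).symm⟩
        obtain ⟨k1, k2⟩ := key i j h3 h4
        obtain ⟨k3, k4⟩ := key i l h8 h9
        obtain ⟨k5, k6⟩ := key j l h10 h11
        refine ⟨⟨![i, τ i, j, τ j, l, τ l], ?_⟩, ?_, rfl⟩
        · intro a b
          fin_cases a <;> fin_cases b <;>
            simp [h1, Ne.symm h1, h2, Ne.symm h2, h3, Ne.symm h3, h4, Ne.symm h4, h7,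
              Ne.symm h7, h8, Ne.symm h8,
              h9, Ne.symm h9, h10, Ne.symm h10, h11, Ne.symm h11, k1, Ne.symm k1, k2, Ne.symm k2,
              k3, Ne.symm k3, k4, Ne.symm k4, k5, Ne.symm k5, k6, Ne.symm k6]
        · simp only [mem_filter, mem_univ, true_and, hR]
          exact ⟨⟨h1, rfl⟩, ⟨h2, rfl⟩, h7, rfl⟩
    rw [this, card_sigma]
    push_cast
    rw [sum_congr rfl (g := fun _ => (2 * (k : ℤ) - 2) * (2 * k - 4)) fun i hi => ?_, sum_const, hk]
    · simp; ring
    · rw [card_sigma]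
      push_cast
      rw [sum_congr rfl (c4 i hi), sum_const, nsmul_eq_mul, c2 i hi]

end Matching

section Plane

open Configuration

variable {P : Type*} (L : Type*) [Membership P L]

/-- Three points are collinear if some line contains them. -/
def Col (x y z : P) : Prop := ∃ l : L, x ∈ l ∧ y ∈ l ∧ z ∈ l

/-- A family of distinct points, no three of them collinear. -/
def IsArc {ι : Type*} (p : ι → P) : Prop :=
  Function.Injective p ∧ ∀ i j k : ι, i ≠ j → i ≠ k → j ≠ k → ¬ Col L (p i) (p j) (p k)

/-- The three lines joining consecutive pairs of the six given points are concurrent. -/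
def Conc (p : Fin 6 → P) : Prop :=
  ∃ x : P, Col L (p 0) (p 1) x ∧ Col L (p 2) (p 3) x ∧ Col L (p 4) (p 5) x

variable {L}

lemma Col.swap {x y z : P} : Col L x y z → Col L y x z := fun ⟨l, h1, h2, h3⟩ => ⟨l, h2, h1, h3⟩

lemma Col.rotate {x y z : P} : Col L x y z → Col L y z x := fun ⟨l, h1, h2, h3⟩ => ⟨l, h2, h3, h1⟩

lemma Col.trans [Nondegenerate P L] {x y a b : P} (h : x ≠ y) (ha : Col L x y a)
    (hb : Col L x y b) : Col L x a b := by
  obtain ⟨l, h1, h2, h3⟩ := ha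
  obtain ⟨m, h4, h5, h6⟩ := hb
  obtain rfl := (Nondegenerate.eq_or_eq h1 h2 h4 h5).resolve_left h
  exact ⟨l, h1, h3, h6⟩

lemma IsArc.comp {ι κ : Type*} {p : ι → P} (hp : IsArc L p) {f : κ → ι}
    (hf : Function.Injective f) : IsArc L (p ∘ f) :=
  ⟨hp.1.comp hf, fun _ _ _ h1 h2 h3 => hp.2 _ _ _ (hf.ne h1) (hf.ne h2) (hf.ne h3)⟩

lemma isArc_comp_equiv {ι κ : Type*} {p : ι → P} (f : κ ≃ ι) : IsArc L (p ∘ f) ↔ IsArc L p :=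
  ⟨fun h => by simpa [Function.comp_assoc] using h.comp f.symm.injective,
    fun h => h.comp f.injective⟩

lemma isArc_cons {n : ℕ} {p : Fin n → P} {x : P} :
    IsArc L (Fin.cons x p : Fin (n + 1) → P) ↔
      IsArc L p ∧ x ∉ Set.range p ∧ ∀ i j, i ≠ j → ¬ Col L (p i) (p j) x := by
  constructor
  · intro h
    refine ⟨?_, (Fin.cons_injective_iff.1 h.1).1, fun i j hij => ?_⟩
    · have := h.comp (Fin.succ_injective n)
      exact this
    · have := h.2 i.succ j.succ 0 (by simpa using hij) (Fin.succ_ne_zero _) (Fin.succ_ne_zero _)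
      simpa using this
  · rintro ⟨h1, h2, h3⟩
    refine ⟨Fin.cons_injective_iff.2 ⟨h2, h1.1⟩, fun i j k => ?_⟩
    induction i using Fin.cases <;> induction j using Fin.cases <;>
      induction k using Fin.cases <;> intro h4 h5 h6
    all_goals first | exact absurd rfl h4 | exact absurd rfl h5 | exact absurd rfl h6 | skip
    all_goals simp only [Fin.cons_zero, Fin.cons_succ]
    · exact fun h => h3 _ _ (fun e => h6 (by rw [e])) h.rotate
    · exact fun h => h3 _ _ (fun e => h5 (by rw [e])) h.rotate.rotate.swap
    · exact h3 _ _ (fun e => h4 (by rw [e]))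
    · exact h1.2 _ _ _ (fun e => h4 (by rw [e])) (fun e => h5 (by rw [e]))
        (fun e => h6 (by rw [e]))

lemma IsArc.not_mem_range {n : ℕ} {p : Fin n → P} (hp : IsArc L p) {i j k l : Fin n} {x : P}
    (hij : i ≠ j) (hkl : k ≠ l) (hik : i ≠ k) (hil : i ≠ l) (hjk : j ≠ k) (hjl : j ≠ l)
    (h : Col L (p i) (p j) x) (h' : Col L (p k) (p l) x) : x ∉ Set.range p := by
  rintro ⟨m, rfl⟩
  by_cases h1 : m = i
  · subst h1
    exact hp.2 k l m hkl hik.symm hil.symm h'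
  by_cases h2 : m = j
  · subst h2
    exact hp.2 k l m hkl hjk.symm hjl.symm h'
  exact hp.2 i j m hij (Ne.symm h1) (Ne.symm h2) h

variable [ProjectivePlane P L]

lemma existsUnique_meet {a b c d : P} (hab : a ≠ b) (hcd : c ≠ d) (h : ¬ Col L a b c) :
    ∃! x, Col L a b x ∧ Col L c d x := by
  obtain ⟨l, ⟨hal, hbl⟩, hl⟩ := HasLines.existsUnique_line P L a b hab
  obtain ⟨m, ⟨hcm, hdm⟩, hm⟩ := HasLines.existsUnique_line P L c d hcd
  have hlm : l ≠ m := by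
    rintro rfl
    exact h ⟨l, hal, hbl, hcm⟩
  obtain ⟨x, hx, hux⟩ := HasPoints.existsUnique_point P L l m hlm
  refine ⟨x, ⟨⟨l, hal, hbl, hx.1⟩, ⟨m, hcm, hdm, hx.2⟩⟩, ?_⟩
  rintro y ⟨⟨l', h1, h2, h3⟩, ⟨m', h4, h5, h6⟩⟩
  obtain rfl := hl l' ⟨h1, h2⟩
  obtain rfl := hm m' ⟨h4, h5⟩
  exact hux y ⟨h3, h6⟩

variable [Fintype P] [Finite L]

open Classical in
lemma card_col {a b : P} (hab : a ≠ b) :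
    #{x : P | Col L a b x} = ProjectivePlane.order P L + 1 := by
  obtain ⟨l, ⟨hal, hbl⟩, hl⟩ := HasLines.existsUnique_line P L a b hab
  rw [← ProjectivePlane.pointCount_eq P l, pointCount, Nat.card_eq_fintype_card,
    Fintype.card_subtype]
  congr 1
  ext x
  simp only [mem_filter, mem_univ, true_and]
  constructor
  · rintro ⟨m, h1, h2, h3⟩
    exact hl m ⟨h1, h2⟩ ▸ h3
  · exact fun h => ⟨l, hal, hbl, h⟩

variable (L)

open Classical in
/-- The number of ordered triples of pairs of points of `p` spanning concurrent lines. -/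
noncomputable def concCount {n : ℕ} (p : Fin n → P) : ℕ :=
  #{f : Fin 6 ↪ Fin n | Conc L (p ∘ f)}

/-- The number of points extending an `n`-arc, times `48`, if no concurrences occur. -/
def extPoly (q : ℤ) (n : ℕ) : ℤ :=
  48 * (q ^ 2 + q + 1 - n) - 24 * n.descFactorial 2 * (q - 1) + 6 * n.descFactorial 4

variable {L}

open Classical in
/-- Inclusion-exclusion for the points off the secants of an arc. -/
lemma card_extensions {n : ℕ} {p : Fin n → P} (hp : IsArc L p) (hn : n ≤ 7) :
    48 * (#{x : P | IsArc L (Fin.cons x p : Fin (n + 1) → P)} : ℤ) =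
      extPoly (ProjectivePlane.order P L) n - concCount L p := by
  set q := ProjectivePlane.order P L with hq
  set U : Finset P := {x | x ∉ Set.range p} with hU
  have hUmem : ∀ x, x ∈ U ↔ x ∉ Set.range p := by simp [hU]
  have hUcard : (#U : ℤ) = (q : ℤ) ^ 2 + q + 1 - n := by
    have h1 : U = univ \ univ.image p := by
      ext x; simp [hU]
    have h2 := card_sdiff_add_card_eq_card (subset_univ (univ.image p))
    rw [← h1, card_image_of_injective _ hp.1, card_univ, card_univ, Fintype.card_fin,
      ProjectivePlane.card_points P L] at h2
    push_cast [← hq] at h2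
    zify at h2
    linarith
  have hpt : ∀ x ∈ U, (48 * (if IsArc L (Fin.cons x p : Fin (n + 1) → P) then 1 else 0) : ℤ) =
      48 - 24 * #{f : Fin 2 ↪ Fin n | Col L (p (f 0)) (p (f 1)) x}
        + 6 * #{f : Fin 4 ↪ Fin n | Col L (p (f 0)) (p (f 1)) x ∧ Col L (p (f 2)) (p (f 3)) x}
        - #{f : Fin 6 ↪ Fin n | Col L (p (f 0)) (p (f 1)) x ∧ Col L (p (f 2)) (p (f 3)) x ∧
            Col L (p (f 4)) (p (f 5)) x} := by
    intro x hx
    obtain ⟨k, hk, hk0, h2, h4, h6⟩ := card_matching_tuples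
      (R := fun i j => i ≠ j ∧ Col L (p i) (p j) x) (fun i h => h.1 rfl)
      (fun i j h => ⟨h.1.symm, h.2.swap⟩) (fun i j k h1 h2 => by
        by_contra h3
        refine hp.2 i j k h1.1 h2.1 h3 ?_
        refine Col.trans (y := x) (fun e => (hUmem x).1 hx ⟨i, e⟩) ?_ ?_
        · exact h1.2.rotate.rotate.swap
        · exact h2.2.rotate.rotate.swap)
    have e2 : ∀ f : Fin 2 ↪ Fin n, f 0 ≠ f 1 := fun f => f.injective.ne (by decide)
    have e4 : ∀ f : Fin 4 ↪ Fin n, f 0 ≠ f 1 ∧ f 2 ≠ f 3 := fun f =>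
      ⟨f.injective.ne (by decide), f.injective.ne (by decide)⟩
    have e6 : ∀ f : Fin 6 ↪ Fin n, f 0 ≠ f 1 ∧ f 2 ≠ f 3 ∧ f 4 ≠ f 5 := fun f =>
      ⟨f.injective.ne (by decide), f.injective.ne (by decide), f.injective.ne (by decide)⟩
    simp only [ne_eq, e2, not_false_eq_true, true_and] at h2
    simp only [ne_eq, (e4 _).1, (e4 _).2, not_false_eq_true, true_and] at h4
    simp only [ne_eq, (e6 _).1, (e6 _).2.1, (e6 _).2.2, not_false_eq_true, true_and] at h6
    rw [h2, h4, h6]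
    have harc : IsArc L (Fin.cons x p : Fin (n + 1) → P) ↔ k = 0 := by
      rw [isArc_cons, hk0]
      exact ⟨fun h i j h' => h.2.2 i j h'.1 h'.2,
        fun h => ⟨hp, (hUmem x).1 hx, fun i j h1 h2 => h i j ⟨h1, h2⟩⟩⟩
    simp only [harc]
    rw [Fintype.card_fin] at hk
    have : k ≤ 3 := by omega
    interval_cases k <;> norm_num
  have hext : (#{x : P | IsArc L (Fin.cons x p : Fin (n + 1) → P)} : ℤ) =
      ∑ x ∈ U, if IsArc L (Fin.cons x p : Fin (n + 1) → P) then 1 else 0 := by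
    rw [sum_boole]
    congr 2
    ext x
    simp only [mem_filter, mem_univ, true_and, hUmem]
    exact ⟨fun h => ⟨(isArc_cons.1 h).2.1, h⟩, fun h => h.2⟩
  have hswap : ∀ {α : Type} [Fintype α] (S : α → P → Prop) [∀ f x, Decidable (S f x)],
      ∑ x ∈ U, (#{f : α | S f x} : ℤ) = ∑ f : α, (#{x ∈ U | S f x} : ℤ) := by
    intro α _ S _
    simp only [← sum_boole]
    exact sum_comm
  have s2 : ∑ x ∈ U, (#{f : Fin 2 ↪ Fin n | Col L (p (f 0)) (p (f 1)) x} : ℤ) =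
      n.descFactorial 2 * ((q : ℤ) - 1) := by
    rw [hswap, sum_congr rfl (g := fun _ => (q : ℤ) - 1), sum_const, card_univ,
      Fintype.card_embedding_eq, Fintype.card_fin, Fintype.card_fin, nsmul_eq_mul]
    intro f _
    have hne : f 0 ≠ f 1 := f.injective.ne (by decide)
    have h1 : ({x ∈ U | Col L (p (f 0)) (p (f 1)) x} : Finset P) =
        ({x | Col L (p (f 0)) (p (f 1)) x} : Finset P) \ {p (f 0), p (f 1)} := by
      ext x
      simp only [mem_filter, mem_univ, true_and, mem_sdiff, mem_insert, mem_singleton, hUmem]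
      constructor
      · rintro ⟨h1, h2⟩
        refine ⟨h2, ?_⟩
        rintro (rfl | rfl) <;> exact h1 ⟨_, rfl⟩
      · rintro ⟨h1, h2⟩
        refine ⟨?_, h1⟩
        rintro ⟨m, rfl⟩
        exact hp.2 _ _ m hne (fun e => h2 (Or.inl (by rw [e])))
          (fun e => h2 (Or.inr (by rw [e]))) h1
    obtain ⟨l, hl⟩ := HasLines.existsUnique_line P L _ _ (hp.1.ne hne)
    have h2 : ({p (f 0), p (f 1)} : Finset P) ⊆ ({x | Col L (p (f 0)) (p (f 1)) x} : Finset P) := by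
      intro x
      simp only [mem_filter, mem_univ, true_and, mem_insert, mem_singleton]
      rintro (rfl | rfl)
      · exact ⟨l, hl.1.1, hl.1.2, hl.1.1⟩
      · exact ⟨l, hl.1.1, hl.1.2, hl.1.2⟩
    have h3 := card_sdiff_add_card_eq_card h2
    rw [← h1, card_pair (hp.1.ne hne), card_col (hp.1.ne hne), ← hq] at h3
    zify at h3
    linarith
  have meet : ∀ f : Fin 4 ↪ Fin n,
      ∃! x, Col L (p (f 0)) (p (f 1)) x ∧ Col L (p (f 2)) (p (f 3)) x := fun f =>
    existsUnique_meet (hp.1.ne (f.injective.ne (by decide))) (hp.1.ne (f.injective.ne (by decide)))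
      (hp.2 _ _ _ (f.injective.ne (by decide)) (f.injective.ne (by decide))
        (f.injective.ne (by decide)))
  have off : ∀ (f : Fin 4 ↪ Fin n) (x), Col L (p (f 0)) (p (f 1)) x →
      Col L (p (f 2)) (p (f 3)) x → x ∉ Set.range p := fun f x => by
    apply hp.not_mem_range <;> exact f.injective.ne (by decide)
  have s4 : ∑ x ∈ U, (#{f : Fin 4 ↪ Fin n | Col L (p (f 0)) (p (f 1)) x ∧
      Col L (p (f 2)) (p (f 3)) x} : ℤ) = n.descFactorial 4 := by
    rw [hswap, sum_congr rfl (g := fun _ => (1 : ℤ)), sum_const, card_univ,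
      Fintype.card_embedding_eq, Fintype.card_fin, Fintype.card_fin, nsmul_eq_mul, mul_one]
    intro f _
    obtain ⟨x, hx, hux⟩ := meet f
    norm_cast
    rw [card_eq_one]
    refine ⟨x, ?_⟩
    ext y
    simp only [mem_filter, mem_singleton, hUmem]
    exact ⟨fun h => hux y h.2, fun h => h ▸ ⟨off f x hx.1 hx.2, hx⟩⟩
  have s6 : ∑ x ∈ U, (#{f : Fin 6 ↪ Fin n | Col L (p (f 0)) (p (f 1)) x ∧
      Col L (p (f 2)) (p (f 3)) x ∧ Col L (p (f 4)) (p (f 5)) x} : ℤ) = concCount L p := by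
    rw [hswap, concCount, ← sum_boole]
    refine sum_congr rfl fun f _ => ?_
    obtain ⟨x, hx, hux⟩ := meet ((Fin.castLEEmb (by norm_num)).trans f)
    split_ifs with hc
    · obtain ⟨y, hy⟩ := hc
      norm_cast
      rw [card_eq_one]
      refine ⟨y, ?_⟩
      ext z
      simp only [mem_filter, mem_singleton, hUmem]
      refine ⟨fun h => ?_, fun h => h ▸
        ⟨off ((Fin.castLEEmb (by norm_num)).trans f) y hy.1 hy.2.1, hy⟩⟩
      rw [hux z ⟨h.2.1, h.2.2.1⟩, hux y ⟨hy.1, hy.2.1⟩]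
    · norm_cast
      rw [card_eq_zero, filter_eq_empty_iff]
      exact fun x _ h => hc ⟨x, h⟩
  rw [hext, mul_sum, sum_congr rfl hpt, sum_sub_distrib, sum_add_distrib, sum_sub_distrib,
    ← mul_sum, ← mul_sum, s2, s4, s6, sum_const, nsmul_eq_mul, hUcard, extPoly]
  ring

open Classical in
/-- Counting `(n + 1)`-arcs whose last `n` points satisfy `Q`. -/
lemma card_arcs_succ {n : ℕ} (hn : n ≤ 7) (Q : (Fin n → P) → Prop) :
    48 * (#{p : Fin (n + 1) → P | IsArc L p ∧ Q (p ∘ Fin.succ)} : ℤ) =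
      extPoly (ProjectivePlane.order P L) n * #{p : Fin n → P | IsArc L p ∧ Q p} -
        ∑ f : Fin 6 ↪ Fin n, (#{p : Fin n → P | IsArc L p ∧ Q p ∧ Conc L (p ∘ f)} : ℤ) := by
  have h1 : #{p : Fin (n + 1) → P | IsArc L p ∧ Q (p ∘ Fin.succ)} =
      ∑ p : Fin n → P with IsArc L p ∧ Q p,
        #{x : P | IsArc L (Fin.cons x p : Fin (n + 1) → P)} := by
    rw [← card_sigma]
    refine card_bij (fun p _ => ⟨p ∘ Fin.succ, p 0⟩) ?_ ?_ ?_
    · intro p hp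
      simp only [mem_filter, mem_univ, true_and, mem_sigma] at hp ⊢
      refine ⟨⟨hp.1.comp (Fin.succ_injective n), hp.2⟩, ?_⟩
      convert hp.1 using 1
      exact Fin.cons_self_tail p
    · intro p _ p' _ h
      simp only [Sigma.mk.injEq, heq_eq_eq] at h
      funext i
      induction i using Fin.cases with
      | zero => exact h.2
      | succ i => exact congrFun h.1 i
    · rintro ⟨p, x⟩ hp
      simp only [mem_filter, mem_univ, true_and, mem_sigma] at hp
      refine ⟨Fin.cons x p, ?_, ?_⟩
      · simp only [mem_filter, mem_univ, true_and]
        exact ⟨hp.2, hp.1.2⟩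
      · rfl
  have h2 : ∑ p : Fin n → P with IsArc L p ∧ Q p, (concCount L p : ℤ) =
      ∑ f : Fin 6 ↪ Fin n, (#{p : Fin n → P | IsArc L p ∧ Q p ∧ Conc L (p ∘ f)} : ℤ) := by
    simp only [concCount, ← sum_boole]
    rw [sum_comm]
    refine sum_congr rfl fun f _ => ?_
    rw [sum_filter]
    refine sum_congr rfl fun p _ => ?_
    by_cases h1 : IsArc L p <;> by_cases h2 : Q p <;> simp [h1, h2]
  rw [h1, ← h2]
  push_cast
  rw [mul_sum, sum_congr rfl (fun p hp => card_extensions (mem_filter.1 hp).2.1 hn),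
    sum_sub_distrib, sum_const, nsmul_eq_mul, mul_comm]

end Plane

section Symmetry

open Equiv Configuration

/-- The permutation `h` preserves the partition `{0, 1}, {2, 3}, {4, 5}`. -/
def RespectsPairs (h : Perm (Fin 6)) : Prop :=
  ∀ i j : Fin 6, i.val / 2 = j.val / 2 ↔ (h i).val / 2 = (h j).val / 2

instance : DecidablePred RespectsPairs := fun h => by unfold RespectsPairs; infer_instance

/-- The number of pairs `{0, 1}, {2, 3}, {4, 5}` mapped to such pairs by `f`. -/
def commonPairs (f : Perm (Fin 6)) : ℕ :=
  #{i : Fin 3 | (f ⟨2 * i, by omega⟩).val / 2 = (f ⟨2 * i + 1, by omega⟩).val / 2}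

lemma commonPairs_cases : ∀ f : Perm (Fin 6),
    commonPairs f = 0 ∨ commonPairs f = 1 ∨ commonPairs f = 3 := by
  decide +kernel

lemma card_commonPairs : #{f | commonPairs f = 0} = 384 ∧ #{f | commonPairs f = 1} = 288 ∧
    #{f | commonPairs f = 3} = 48 := by
  decide +kernel

lemma respectsPairs_of_commonPairs : ∀ f, commonPairs f = 3 → RespectsPairs f := by
  decide +kernel

lemma exists_of_commonPairs_one : ∀ f, commonPairs f = 1 →
    ∃ g, RespectsPairs g ∧ RespectsPairs (f⁻¹ * g * swap 3 4) := by
  have h : ∀ f, commonPairs f = 1 →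
      ∃ g ∈ [1, swap 2 3, swap 0 2 * swap 1 3, swap 0 2 * swap 1 3 * swap 2 3,
          swap 0 4 * swap 1 5, swap 0 4 * swap 1 5 * swap 2 3],
        RespectsPairs g ∧ RespectsPairs (f⁻¹ * g * swap 3 4) := by
    decide +kernel
  exact fun f hf => let ⟨g, _, hg⟩ := h f hf; ⟨g, hg⟩

lemma exists_of_commonPairs_zero : ∀ f, commonPairs f = 0 →
    ∃ g, RespectsPairs g ∧ RespectsPairs (f⁻¹ * g * finRotate 6) := by
  have h : ∀ f, commonPairs f = 0 →
      ∃ g ∈ [1, swap 0 1, swap 2 3, swap 4 5, swap 0 1 * swap 2 3, swap 0 1 * swap 4 5,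
          swap 2 3 * swap 4 5, swap 0 1 * swap 2 3 * swap 4 5],
        RespectsPairs g ∧ RespectsPairs (f⁻¹ * g * finRotate 6) := by
    decide +kernel
  exact fun f hf => let ⟨g, _, hg⟩ := h f hf; ⟨g, hg⟩

variable {P L : Type*} [Membership P L]

lemma conc_iff {p : Fin 6 → P} :
    Conc L p ↔ ∃ x, ∀ i j : Fin 6, i ≠ j → i.val / 2 = j.val / 2 → Col L (p i) (p j) x := by
  refine exists_congr fun x => ⟨fun h i j => ?_, fun h => ?_⟩
  · have h' := And.intro h.1.swap (And.intro h.2.1.swap h.2.2.swap)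
    fin_cases i <;> fin_cases j <;> simp [h, h']
  · exact ⟨h 0 1 (by decide) rfl, h 2 3 (by decide) rfl, h 4 5 (by decide) rfl⟩

lemma Conc.comp {p : Fin 6 → P} (hp : Conc L p) {h : Perm (Fin 6)} (hh : RespectsPairs h) :
    Conc L (p ∘ h) := by
  obtain ⟨x, hx⟩ := conc_iff.1 hp
  exact conc_iff.2 ⟨x, fun i j h1 h2 => hx _ _ (h.injective.ne h1) ((hh i j).1 h2)⟩

lemma RespectsPairs.inv {h : Perm (Fin 6)} (hh : RespectsPairs h) : RespectsPairs h⁻¹ :=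
  fun i j => by simpa using (hh (h⁻¹ i) (h⁻¹ j)).symm

lemma RespectsPairs.conc_comp {h : Perm (Fin 6)} (hh : RespectsPairs h) {p : Fin 6 → P} :
    Conc L (p ∘ h) ↔ Conc L p := by
  refine ⟨fun hc => ?_, fun hc => hc.comp hh⟩
  convert hc.comp hh.inv using 1
  funext i
  simp

variable (P L) [Fintype P]

open Classical in
/-- The number of `6`-arcs that are concurrent for the two matchings `{0, 1}, {2, 3}, {4, 5}`
and its image under `f`. -/
noncomputable def biconcCount (f : Perm (Fin 6)) : ℕ :=
  #{p : Fin 6 → P | IsArc L p ∧ Conc L p ∧ Conc L (p ∘ f)}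

variable {P L}

lemma card_congr_comp {n : ℕ} {A B : (Fin n → P) → Prop} [DecidablePred A] [DecidablePred B]
    (g : Perm (Fin n))
    (h : ∀ p, A p ↔ B (p ∘ g)) : #{p | A p} = #{p | B p} := by
  refine card_equiv (Equiv.arrowCongr g.symm (Equiv.refl P)) fun p => ?_
  simp only [mem_filter, mem_univ, true_and, h]
  rfl

lemma biconcCount_eq {f f' g : Perm (Fin 6)} (hg : RespectsPairs g)
    (h : RespectsPairs (f⁻¹ * g * f')) : biconcCount P L f = biconcCount P L f' := by
  classical
  refine card_congr_comp (A := fun p => IsArc L p ∧ Conc L p ∧ Conc L (p ∘ f))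
    (B := fun p => IsArc L p ∧ Conc L p ∧ Conc L (p ∘ f')) g fun p => ?_
  rw [isArc_comp_equiv, hg.conc_comp, ← h.conc_comp (p := p ∘ f)]
  have : (p ∘ f) ∘ ⇑(f⁻¹ * g * f') = (p ∘ g) ∘ f' := by
    funext i
    simp
  rw [this]

open Classical in
/-- The sum of `biconcCount` over all matchings, sorted by the number of common pairs. -/
lemma sum_biconcCount :
    ∑ f : Fin 6 ↪ Fin 6, (#{p : Fin 6 → P | IsArc L p ∧ Conc L p ∧ Conc L (p ∘ f)} : ℤ) =
      48 * #{p : Fin 6 → P | IsArc L p ∧ Conc L p} + 288 * biconcCount P L (swap 3 4) +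
        384 * biconcCount P L (finRotate 6) := by
  have h1 : ∑ f : Fin 6 ↪ Fin 6,
      (#{p : Fin 6 → P | IsArc L p ∧ Conc L p ∧ Conc L (p ∘ f)} : ℤ) =
      ∑ f : Perm (Fin 6), (biconcCount P L f : ℤ) := by
    refine Fintype.sum_equiv (Equiv.embeddingEquivOfFinite (Fin 6)) _ _ fun f => ?_
    rfl
  have h2 : ∀ f : Perm (Fin 6), (biconcCount P L f : ℤ) =
      (if commonPairs f = 3 then (#{p : Fin 6 → P | IsArc L p ∧ Conc L p} : ℤ) else 0) +
      (if commonPairs f = 1 then (biconcCount P L (swap 3 4) : ℤ) else 0) +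
      (if commonPairs f = 0 then (biconcCount P L (finRotate 6) : ℤ) else 0) := by
    intro f
    rcases commonPairs_cases f with h | h | h
    · obtain ⟨g, hg, hf⟩ := exists_of_commonPairs_zero f h
      simp [h, biconcCount_eq hg hf]
    · obtain ⟨g, hg, hf⟩ := exists_of_commonPairs_one f h
      simp [h, biconcCount_eq hg hf]
    · have hf := respectsPairs_of_commonPairs f h
      simp [h, biconcCount, hf.conc_comp]
  obtain ⟨c0, c1, c3⟩ := card_commonPairs
  rw [h1, sum_congr rfl fun f _ => h2 f, sum_add_distrib, sum_add_distrib]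
  simp only [sum_ite, sum_const, c0, c1, c3, nsmul_eq_mul]
  norm_num

open Classical in
/-- All ways of choosing six points of an arc to be concurrent are equally frequent. -/
lemma card_conc_comp {n : ℕ} (f g : Fin 6 ↪ Fin n) :
    #{p : Fin n → P | IsArc L p ∧ Conc L (p ∘ f)} =
      #{p : Fin n → P | IsArc L p ∧ Conc L (p ∘ g)} := by
  obtain ⟨σ, rfl⟩ := (MulAction.isMultiplyPretransitive_iff.1
    (Equiv.Perm.isMultiplyPretransitive (Fin n) 6)) g f
  refine card_congr_comp (A := fun p => IsArc L p ∧ Conc L (p ∘ (σ • g)))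
    (B := fun p => IsArc L p ∧ Conc L (p ∘ g)) σ fun p => ?_
  rw [isArc_comp_equiv]
  rfl

end Symmetry

section Recursion

open Configuration

variable {P : Type*} (L : Type*) [Membership P L] [Fintype P]

variable (P) in
open Classical in
/-- The number of ordered `n`-arcs. -/
noncomputable def arcCount (n : ℕ) : ℕ := #{p : Fin n → P | IsArc L p}

variable (P) in
open Classical in
/-- The number of ordered `6`-arcs `p` with `p 0 p 1`, `p 2 p 3` and `p 4 p 5` concurrent. -/
noncomputable def concArcCount : ℕ := #{p : Fin 6 → P | IsArc L p ∧ Conc L p}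

lemma arcCount_zero : arcCount P L 0 = 1 := by
  classical
  rw [arcCount, card_eq_one]
  refine ⟨Fin.elim0, ?_⟩
  ext p
  simp only [mem_filter, mem_univ, true_and, mem_singleton]
  exact ⟨fun _ => Subsingleton.elim _ _, fun _ =>
    ⟨fun i => i.elim0, fun i => i.elim0⟩⟩

variable [ProjectivePlane P L] [Finite L]

lemma arcCount_succ {n : ℕ} (hn : n ≤ 7) (g : Fin 6 ↪ Fin n) :
    48 * (arcCount P L (n + 1) : ℤ) = extPoly (ProjectivePlane.order P L) n * arcCount P L n -
      n.descFactorial 6 * (open Classical in #{p : Fin n → P | IsArc L p ∧ Conc L (p ∘ g)}) := by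
  classical
  have h := card_arcs_succ (L := L) (P := P) hn (fun _ => True)
  simp only [and_true, true_and] at h
  rw [sum_congr rfl fun f _ => by rw [card_conc_comp f g], sum_const, card_univ,
    Fintype.card_embedding_eq, Fintype.card_fin, Fintype.card_fin, nsmul_eq_mul] at h
  rw [arcCount, arcCount]
  exact h

lemma arcCount_succ_of_lt {n : ℕ} (hn : n < 6) :
    48 * (arcCount P L (n + 1) : ℤ) =
      extPoly (ProjectivePlane.order P L) n * arcCount P L n := by
  classical
  have h := card_arcs_succ (L := L) (P := P) (n := n) (by omega) (fun _ => True)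
  have : IsEmpty (Fin 6 ↪ Fin n) := ⟨fun f => by
    have := Fintype.card_le_of_embedding f
    simp at this
    omega⟩
  simp only [and_true, univ_eq_empty, sum_empty, sub_zero] at h
  rw [arcCount, arcCount]
  exact h

lemma card_arcs_seven_conc :
    48 * ((open Classical in #{p : Fin 7 → P | IsArc L p ∧ Conc L (p ∘ Fin.succ)} : ℕ) : ℤ) =
      (extPoly (ProjectivePlane.order P L) 6 - 48) * concArcCount P L -
        288 * biconcCount P L (Equiv.swap 3 4) - 384 * biconcCount P L (finRotate 6) := by
  classical
  have h := card_arcs_succ (L := L) (P := P) (n := 6) (by norm_num) (fun p => Conc L p)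
  rw [sum_biconcCount] at h
  rw [concArcCount]
  linear_combination h

variable {L} in
/-- The number of `4`-arcs and of `8`-arcs, in terms of special `6`-arcs. -/
lemma arcCount_four_eight {q : ℤ} (hq : q = ProjectivePlane.order P L) :
    (arcCount P L 4 : ℤ) = (q ^ 2 + q + 1) * (q ^ 2 + q) * q ^ 2 * (q - 1) ^ 2 ∧
    (arcCount P L 8 : ℤ) = (q ^ 2 - 20 * q + 120) * ((q ^ 2 - 14 * q + 55) *
        ((q ^ 2 - 9 * q + 21) * ((q ^ 2 - 5 * q + 6) * arcCount P L 4))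
          - 15 * concArcCount P L) -
      105 * ((q ^ 2 - 14 * q + 54) * concArcCount P L - 6 * biconcCount P L (Equiv.swap 3 4)
        - 8 * biconcCount P L (finRotate 6)) := by
  have h0 := arcCount_zero (P := P) L
  have h1 := arcCount_succ_of_lt (P := P) L (n := 0) (by norm_num)
  have h2 := arcCount_succ_of_lt (P := P) L (n := 1) (by norm_num)
  have h3 := arcCount_succ_of_lt (P := P) L (n := 2) (by norm_num)
  have h4 := arcCount_succ_of_lt (P := P) L (n := 3) (by norm_num)
  have h5 := arcCount_succ_of_lt (P := P) L (n := 4) (by norm_num)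
  have h6 := arcCount_succ_of_lt (P := P) L (n := 5) (by norm_num)
  have h7 := arcCount_succ (P := P) L (n := 6) (by norm_num) (Function.Embedding.refl _)
  obtain ⟨N, h8, h9⟩ : ∃ N : ℕ,
      48 * (arcCount P L 8 : ℤ) = extPoly (ProjectivePlane.order P L) 7 * arcCount P L 7 -
        Nat.descFactorial 7 6 * N ∧
      48 * (N : ℤ) = (extPoly (ProjectivePlane.order P L) 6 - 48) * concArcCount P L -
        288 * biconcCount P L (Equiv.swap 3 4) - 384 * biconcCount P L (finRotate 6) :=
    ⟨_, arcCount_succ (P := P) L (n := 7) (by norm_num) (Fin.succEmb 6),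
      card_arcs_seven_conc (P := P) L⟩
  change _ = _ - _ * (concArcCount P L : ℤ) at h7
  have e2 : ∀ n : ℕ, n.descFactorial 2 = n * (n - 1) := fun n => by
    simp [Nat.descFactorial_succ, mul_comm]
  simp only [extPoly, ← hq, e2] at h1 h2 h3 h4 h5 h6 h7 h8 h9
  norm_num [Nat.descFactorial_succ, h0] at h1 h2 h3 h4 h5 h6 h7 h8 h9
  replace h2 : (arcCount P L 2 : ℤ) = (q ^ 2 + q) * arcCount P L 1 := by linarith
  replace h3 : (arcCount P L 3 : ℤ) = q ^ 2 * arcCount P L 2 := by linarith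
  replace h4 : (arcCount P L 4 : ℤ) = (q - 1) ^ 2 * arcCount P L 3 := by linarith
  replace h5 : (arcCount P L 5 : ℤ) = (q ^ 2 - 5 * q + 6) * arcCount P L 4 := by linarith
  replace h6 : (arcCount P L 6 : ℤ) = (q ^ 2 - 9 * q + 21) * arcCount P L 5 := by linarith
  replace h7 : (arcCount P L 7 : ℤ) =
      (q ^ 2 - 14 * q + 55) * arcCount P L 6 - 15 * concArcCount P L := by linarith
  refine ⟨by rw [h4, h3, h2, h1]; ring, ?_⟩
  rw [← h5, ← h6, ← h7]
  linarith

end Recursion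

section Arc

open Configuration

variable {P L : Type*} [Membership P L]

lemma isArc_iff_lt [ProjectivePlane P L] {n : ℕ} {p : Fin (n + 3) → P} :
    IsArc L p ↔ ∀ i j k, i < j → j < k → ¬ Col L (p i) (p j) (p k) := by
  refine ⟨fun h i j k hij hjk => h.2 i j k hij.ne (hij.trans hjk).ne hjk.ne, fun h => ?_⟩
  have h' : ∀ i j k : Fin (n + 3), i ≠ j → i ≠ k → j ≠ k → ¬ Col L (p i) (p j) (p k) := by
    intro i j k hij hik hjk hc
    rcases lt_or_gt_of_ne hij with h1 | h1 <;> rcases lt_or_gt_of_ne hik with h2 | h2 <;>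
      rcases lt_or_gt_of_ne hjk with h3 | h3
    · exact h i j k h1 h3 hc
    · exact h i k j h2 h3 hc.rotate.rotate.swap
    · exact absurd (h1.trans h3) h2.not_gt
    · exact h k i j h2 h1 hc.rotate.rotate
    · exact h j i k h1 h2 hc.swap
    · exact absurd (h2.trans h3) h1.not_gt
    · exact h j k i h3 h2 hc.rotate
    · exact h k j i h3 h1 hc.rotate.swap
  refine ⟨fun i j hij => ?_, h'⟩
  by_contra hne
  obtain ⟨k, hk⟩ : ∃ k, k ∉ ({i, j} : Finset (Fin (n + 3))) := by
    by_contra! hk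
    have := card_le_card (fun k _ => hk k : univ ⊆ ({i, j} : Finset (Fin (n + 3))))
    have := card_le_two (a := i) (b := j)
    simp at *
    omega
  simp only [mem_insert, mem_singleton, not_or] at hk
  refine h' i j k hne (Ne.symm hk.1) (Ne.symm hk.2) ?_
  obtain ⟨y, hy⟩ : ∃ y, y ≠ p i := by
    obtain ⟨p₁, p₂, -, -, l₂, -, h₁, -, -, h₂, -⟩ :=
      ProjectivePlane.exists_config (P := P) (L := L)
    by_contra! hy
    exact h₁ (hy p₁ ▸ hy p₂ ▸ h₂)
  obtain ⟨z, hz, hpz⟩ : ∃ z, z ≠ p i ∧ (p k = p i ∨ p k = z) := by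
    by_cases e : p k = p i
    · exact ⟨y, hy, Or.inl e⟩
    · exact ⟨p k, e, Or.inr rfl⟩
  obtain ⟨l, ⟨h1, h2⟩, -⟩ := HasLines.existsUnique_line P L _ _ hz
  refine ⟨l, h2, hij ▸ h2, ?_⟩
  rcases hpz with e | e <;> rw [e] <;> assumption

lemma not_col_of_meet [Nondegenerate P L] {ι : Type*} {p : ι → P} (hp : IsArc L p)
    {i j k l : ι} {x : P}
    (hij : i ≠ j) (hik : i ≠ k) (hil : i ≠ l) (hjk : j ≠ k) (hkl : k ≠ l)
    (h1 : Col L (p i) (p j) x) (h2 : Col L (p k) (p l) x) : ¬ Col L (p i) (p k) x := by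
  intro h3
  have hx : p i ≠ x := by
    rintro rfl
    exact hp.2 k l i hkl hik.symm hil.symm h2
  exact hp.2 i j k hij hik hjk (Col.trans hx h1.rotate.rotate.swap
    h3.rotate.rotate.swap)

end Arc

section Coordinates

open Configuration Projectivization
open scoped LinearAlgebra.Projectivization

variable {F : Type*} [Field F]

lemma col_mk_iff_det {u v w : Fin 3 → F} (hu : u ≠ 0) (hv : v ≠ 0) (hw : w ≠ 0) :
    Col (ℙ F (Fin 3 → F)) (mk F u hu) (mk F v hv) (mk F w hw) ↔ (Matrix.of ![u, v, w]).det = 0 := by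
  rw [← Matrix.exists_mulVec_eq_zero_iff]
  have key : ∀ x : Fin 3 → F, Matrix.mulVec (Matrix.of ![u, v, w]) x = 0 ↔
      u ⬝ᵥ x = 0 ∧ v ⬝ᵥ x = 0 ∧ w ⬝ᵥ x = 0 := by
    intro x
    simp [funext_iff, Fin.forall_fin_succ]
  simp only [key]
  constructor
  · rintro ⟨l, h1, h2, h3⟩
    induction l with | h x hx =>
    exact ⟨x, hx, h1, h2, h3⟩
  · rintro ⟨x, hx, h1, h2, h3⟩
    exact ⟨mk F x hx, h1, h2, h3⟩

lemma col_mk_iff {u v w : Fin 3 → F} (hu : u ≠ 0) (hv : v ≠ 0) (hw : w ≠ 0) :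
    Col (ℙ F (Fin 3 → F)) (mk F u hu) (mk F v hv) (mk F w hw) ↔
      ¬ LinearIndependent F ![u, v, w] := by
  rw [col_mk_iff_det, ← not_iff_not, not_not, ← ne_eq, ← isUnit_iff_ne_zero,
    ← Matrix.isUnit_iff_isUnit_det, ← Matrix.linearIndependent_rows_iff_isUnit]
  rfl

lemma col_iff_rep {x y z : ℙ F (Fin 3 → F)} :
    Col (ℙ F (Fin 3 → F)) x y z ↔ ¬ LinearIndependent F ![x.rep, y.rep, z.rep] := by
  conv_lhs => rw [← mk_rep x, ← mk_rep y, ← mk_rep z]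
  rw [col_mk_iff]

lemma col_smul (g : (Fin 3 → F) ≃ₗ[F] (Fin 3 → F)) {x y z : ℙ F (Fin 3 → F)} :
    Col (ℙ F (Fin 3 → F)) (g • x) (g • y) (g • z) ↔ Col (ℙ F (Fin 3 → F)) x y z := by
  induction x with | h u hu =>
  induction y with | h v hv =>
  induction z with | h w hw =>
  rw [smul_mk, smul_mk, smul_mk, col_mk_iff, col_mk_iff]
  have : ![g • u, g • v, g • w] = g.toLinearMap ∘ ![u, v, w] := by
    funext i
    fin_cases i <;> rfl
  rw [this, g.toLinearMap.linearIndependent_iff g.ker]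

lemma isArc_smul (g : (Fin 3 → F) ≃ₗ[F] (Fin 3 → F)) {n : ℕ} {p : Fin n → ℙ F (Fin 3 → F)} :
    IsArc (ℙ F (Fin 3 → F)) (g • p) ↔ IsArc (ℙ F (Fin 3 → F)) p := by
  simp only [IsArc, Pi.smul_apply, col_smul]
  refine and_congr_left fun _ => ?_
  exact (MulAction.injective g).of_comp_iff p

lemma conc_smul (g : (Fin 3 → F) ≃ₗ[F] (Fin 3 → F)) {p : Fin 6 → ℙ F (Fin 3 → F)} :
    Conc (ℙ F (Fin 3 → F)) (g • p) ↔ Conc (ℙ F (Fin 3 → F)) p := by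
  refine ((MulAction.surjective g).exists).trans (exists_congr fun x => ?_)
  simp only [Pi.smul_apply, col_smul]

/-- The standard frame. -/
def frameVec : Fin 4 → Fin 3 → F := ![![1, 0, 0], ![0, 1, 0], ![0, 0, 1], ![1, 1, 1]]

/-- The six points on three concurrent lines given by three parameters. -/
def paramVec (t : F × F × F) : Fin 6 → Fin 3 → F :=
  ![![1, 0, 0], ![t.1, 1, 1], ![0, 1, 0], ![1, t.2.1, 1], ![0, 0, 1], ![1, 1, t.2.2]]

lemma frameVec_ne_zero (i : Fin 4) : (frameVec i : Fin 3 → F) ≠ 0 := by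
  fin_cases i <;> simp [frameVec]

lemma paramVec_ne_zero (t : F × F × F) (i : Fin 6) : paramVec t i ≠ 0 := by
  fin_cases i <;> simp [paramVec]

variable (F) in
/-- The points of the standard frame. -/
def framePt (i : Fin 4) : ℙ F (Fin 3 → F) := mk F _ (frameVec_ne_zero i)

/-- The points represented by `paramVec`. -/
def paramPt (t : F × F × F) (i : Fin 6) : ℙ F (Fin 3 → F) := mk F _ (paramVec_ne_zero t i)

lemma exists_smul_frame {r : Fin 4 → ℙ F (Fin 3 → F)} (hr : IsArc (ℙ F (Fin 3 → F)) r) :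
    ∃ g : (Fin 3 → F) ≃ₗ[F] (Fin 3 → F), g • framePt F = r := by
  have hli : LinearIndependent F ![(r 0).rep, (r 1).rep, (r 2).rep] :=
    not_not.1 (mt col_iff_rep.2 (hr.2 0 1 2 (by decide) (by decide) (by decide)))
  set B := basisOfLinearIndependentOfCardEqFinrank hli (by simp) with hB
  have hB' : B 0 = (r 0).rep ∧ B 1 = (r 1).rep ∧ B 2 = (r 2).rep := by simp [hB]
  set c := B.repr (r 3).rep with hc
  have hsum : (r 3).rep = c 0 • (r 0).rep + c 1 • (r 1).rep + c 2 • (r 2).rep := by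
    have := B.sum_repr (r 3).rep
    rw [Fin.sum_univ_three, ← hc, hB'.1, hB'.2.1, hB'.2.2] at this
    exact this.symm
  have hdet : ∀ {i j : Fin 4}, i ≠ j → i ≠ 3 → j ≠ 3 →
      (Matrix.of ![(r i).rep, (r j).rep, (r 3).rep]).det ≠ 0 := by
    intro i j hij hi hj h
    rw [← col_mk_iff_det (rep_nonzero _) (rep_nonzero _) (rep_nonzero _), mk_rep, mk_rep,
      mk_rep] at h
    exact hr.2 i j 3 hij hi hj h
  have hc0 : ∀ i, c i ≠ 0 := by
    intro i h
    fin_cases i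
    · refine hdet (i := 1) (j := 2) (by decide) (by decide) (by decide) ?_
      simp only [Fin.zero_eta] at h
      rw [Matrix.det_fin_three, hsum, h]
      simp
      ring
    · refine hdet (i := 0) (j := 2) (by decide) (by decide) (by decide) ?_
      simp only [Fin.mk_one] at h
      rw [Matrix.det_fin_three, hsum, h]
      simp
      ring
    · refine hdet (i := 0) (j := 1) (by decide) (by decide) (by decide) ?_
      simp only [Fin.reduceFinMk] at h
      rw [Matrix.det_fin_three, hsum, h]
      simp
      ring
  set g := (Pi.basisFun F (Fin 3)).equiv (B.unitsSMul fun i => Units.mk0 (c i) (hc0 i))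
    (Equiv.refl _) with hg
  have hgi : ∀ i, g (Pi.single i 1) = c i • B i := by
    intro i
    rw [← Pi.basisFun_apply, hg, Module.Basis.equiv_apply, Module.Basis.unitsSMul_apply]
    rfl
  have h3 : (frameVec 3 : Fin 3 → F) = Pi.single 0 1 + Pi.single 1 1 + Pi.single 2 1 := by
    funext i
    fin_cases i <;> simp [frameVec]
  have hfr : ∀ i : Fin 4, ∃ a : F, a ≠ 0 ∧ g (frameVec i) = a • (r i).rep := by
    intro i
    fin_cases i
    · exact ⟨c 0, hc0 0, by
        change _ = _ • (r 0).rep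
        rw [← hB'.1, ← hgi]; congr 1; funext i; fin_cases i <;> simp [frameVec]⟩
    · exact ⟨c 1, hc0 1, by
        change _ = _ • (r 1).rep
        rw [← hB'.2.1, ← hgi]; congr 1; funext i; fin_cases i <;> simp [frameVec]⟩
    · exact ⟨c 2, hc0 2, by
        change _ = _ • (r 2).rep
        rw [← hB'.2.2, ← hgi]; congr 1; funext i; fin_cases i <;> simp [frameVec]⟩
    · refine ⟨1, one_ne_zero, ?_⟩
      change g (frameVec 3) = _ • (r 3).rep
      rw [h3, map_add, map_add, hgi, hgi, hgi, hB'.1, hB'.2.1, hB'.2.2, one_smul, hsum]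
  refine ⟨g, funext fun i => ?_⟩
  obtain ⟨a, ha, h⟩ := hfr i
  rw [Pi.smul_apply, framePt, smul_mk, ← mk_rep (r i), mk_eq_mk_iff']
  exact ⟨a, h.symm⟩

end Coordinates

section Fibration

open Configuration Projectivization
open scoped LinearAlgebra.Projectivization

variable {F : Type*} [Field F]

lemma paramPt_frame (t : F × F × F) :
    paramPt t 0 = framePt F 0 ∧ paramPt t 2 = framePt F 1 ∧ paramPt t 4 = framePt F 2 :=
  ⟨rfl, rfl, rfl⟩

lemma col_paramPt (t : F × F × F) (i j k : Fin 6) :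
    Col (ℙ F (Fin 3 → F)) (paramPt t i) (paramPt t j) (paramPt t k) ↔
      (Matrix.of ![paramVec t i, paramVec t j, paramVec t k]).det = 0 :=
  col_mk_iff_det _ _ _

lemma meet_paramPt (t : F × F × F) :
    Col (ℙ F (Fin 3 → F)) (paramPt t 0) (paramPt t 1) (framePt F 3) ∧
      Col (ℙ F (Fin 3 → F)) (paramPt t 2) (paramPt t 3) (framePt F 3) ∧
      Col (ℙ F (Fin 3 → F)) (paramPt t 4) (paramPt t 5) (framePt F 3) := by
  refine ⟨?_, ?_, ?_⟩ <;>
  · rw [paramPt, paramPt, framePt, col_mk_iff_det, Matrix.det_fin_three]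
    simp [paramVec, frameVec]

lemma paramPt_injective : Function.Injective (paramPt : F × F × F → Fin 6 → ℙ F (Fin 3 → F)) := by
  rintro ⟨a, b, c⟩ ⟨a', b', c'⟩ h
  have h1 := congrFun h 1
  have h3 := congrFun h 3
  have h5 := congrFun h 5
  simp only [paramPt, mk_eq_mk_iff'] at h1 h3 h5
  obtain ⟨x, hx⟩ := h1
  obtain ⟨y, hy⟩ := h3
  obtain ⟨z, hz⟩ := h5
  simp [paramVec, funext_iff, Fin.forall_fin_succ] at hx hy hz
  rw [← hx.1, ← hy.2.1, ← hz.2, hx.2, hy.1, hz.1]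
  simp

lemma eq_paramPt {p : Fin 6 → ℙ F (Fin 3 → F)} (hp : IsArc (ℙ F (Fin 3 → F)) p)
    (h0 : p 0 = framePt F 0) (h2 : p 2 = framePt F 1) (h4 : p 4 = framePt F 2)
    (h : Col (ℙ F (Fin 3 → F)) (p 0) (p 1) (framePt F 3) ∧
      Col (ℙ F (Fin 3 → F)) (p 2) (p 3) (framePt F 3) ∧
      Col (ℙ F (Fin 3 → F)) (p 4) (p 5) (framePt F 3)) : ∃ t, paramPt t = p := by
  have n1 := hp.1.ne (show (1 : Fin 6) ≠ 0 by decide)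
  have n3 := hp.1.ne (show (3 : Fin 6) ≠ 2 by decide)
  have n5 := hp.1.ne (show (5 : Fin 6) ≠ 4 by decide)
  rw [h0] at h n1
  rw [h2] at h n3
  rw [h4] at h n5
  obtain ⟨u, hu, hpu⟩ : ∃ u, ∃ hu : u ≠ 0, p 1 = mk F u hu := ⟨_, _, (mk_rep (p 1)).symm⟩
  obtain ⟨v, hv, hpv⟩ : ∃ u, ∃ hu : u ≠ 0, p 3 = mk F u hu := ⟨_, _, (mk_rep (p 3)).symm⟩
  obtain ⟨w, hw, hpw⟩ : ∃ u, ∃ hu : u ≠ 0, p 5 = mk F u hu := ⟨_, _, (mk_rep (p 5)).symm⟩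
  rw [hpu, hpv, hpw] at h
  rw [hpu] at n1
  rw [hpv] at n3
  rw [hpw] at n5
  simp only [framePt, ne_eq, mk_eq_mk_iff', col_mk_iff_det, Matrix.det_fin_three,
    not_exists] at h n1 n3 n5
  simp [frameVec, sub_eq_zero] at h
  have n1 := n1 (u 0)
  have n3 := n3 (v 1)
  have n5 := n5 (w 2)
  simp [frameVec, funext_iff, Fin.forall_fin_succ] at n1 n3 n5
  have hu2 : u 2 ≠ 0 := fun e => n1 (by rw [h.1, e]) e.symm
  have hv2 : v 2 ≠ 0 := fun e => n3 (by linear_combination h.2.1 - e) e.symm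
  have hw1 : w 1 ≠ 0 := fun e => n5 (by rw [h.2.2, e]) e.symm
  have hv0 : v 0 = v 2 := by linear_combination -h.2.1
  refine ⟨(u 0 / u 2, v 1 / v 2, w 2 / w 1), funext fun i => ?_⟩
  fin_cases i
  · exact h0.symm
  · refine Eq.trans ?_ hpu.symm
    refine (mk_eq_mk_iff' ..).2 ⟨(u 2)⁻¹, ?_⟩
    funext i
    fin_cases i <;> simp [paramVec, h.1, hu2, div_eq_inv_mul]
  · exact h2.symm
  · refine Eq.trans ?_ hpv.symm
    refine (mk_eq_mk_iff' ..).2 ⟨(v 2)⁻¹, ?_⟩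
    funext i
    fin_cases i <;> simp [paramVec, hv0, hv2, div_eq_inv_mul]
  · exact h4.symm
  · refine Eq.trans ?_ hpw.symm
    refine (mk_eq_mk_iff' ..).2 ⟨(w 1)⁻¹, ?_⟩
    funext i
    fin_cases i <;> simp [paramVec, h.2.2, hw1, div_eq_inv_mul]

/-- The 4-arcs and the parameters together parametrize the special 6-arcs. -/
lemma biconcCount_eq_mul [Fintype F] [DecidableEq F] [Fintype (ℙ F (Fin 3 → F))]
    (f : Equiv.Perm (Fin 6)) :
    biconcCount (ℙ F (Fin 3 → F)) (ℙ F (Fin 3 → F)) f =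
      arcCount (ℙ F (Fin 3 → F)) (ℙ F (Fin 3 → F)) 4 *
        (open Classical in #{t : F × F × F | IsArc (ℙ F (Fin 3 → F)) (paramPt t) ∧
          Conc (ℙ F (Fin 3 → F)) (paramPt t ∘ f)}) := by
  classical
  have hex : ∀ r : Fin 4 → ℙ F (Fin 3 → F), ∃ g : (Fin 3 → F) ≃ₗ[F] (Fin 3 → F),
      IsArc (ℙ F (Fin 3 → F)) r → g • framePt F = r := fun r => by
    by_cases hr : IsArc (ℙ F (Fin 3 → F)) r
    · exact (exists_smul_frame hr).imp fun g hg _ => hg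
    · exact ⟨1, fun h => absurd h hr⟩
  choose G hG using hex
  rw [arcCount, ← card_product]
  symm
  refine card_bij (fun x _ => G x.1 • paramPt x.2) ?_ ?_ ?_
  · rintro ⟨r, t⟩ h
    simp only [mem_product, mem_filter, mem_univ, true_and] at h ⊢
    exact ⟨(isArc_smul _).2 h.2.1, (conc_smul _).2 ⟨_, meet_paramPt t⟩, (conc_smul (G r)).2 h.2.2⟩
  · rintro ⟨r, t⟩ h ⟨r', t'⟩ h' e
    simp only [mem_product, mem_filter, mem_univ, true_and] at h h' e
    have key : ∀ {r t}, IsArc (ℙ F (Fin 3 → F)) r → r = ![(G r • paramPt t) 0, (G r • paramPt t) 2,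
        (G r • paramPt t) 4, r 3] ∧ Col (ℙ F (Fin 3 → F)) ((G r • paramPt t) 0)
          ((G r • paramPt t) 1) (r 3) ∧ Col (ℙ F (Fin 3 → F)) ((G r • paramPt t) 2)
          ((G r • paramPt t) 3) (r 3) := by
      intro r t hr
      have hg := fun i => (congrFun (hG r hr) i).symm
      obtain ⟨e0, e2, e4⟩ := paramPt_frame t
      refine ⟨?_, ?_, ?_⟩
      · funext i
        fin_cases i
        · exact hg 0
        · exact hg 1
        · exact hg 2
        · rfl
      · rw [hg 3]
        exact (col_smul _).2 (meet_paramPt t).1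
      · rw [hg 3]
        exact (col_smul _).2 (meet_paramPt t).2.1
    have k := key (t := t) h.1
    have k' := key (t := t') h'.1
    rw [← e] at k'
    have hp := (isArc_smul (G r)).2 h.2.1
    have h3 : r 3 = r' 3 := (existsUnique_meet (hp.1.ne (by decide)) (hp.1.ne (by decide))
      (hp.2 0 1 2 (by decide) (by decide) (by decide))).unique k.2 k'.2
    obtain rfl : r = r' := by rw [k.1, k'.1, h3]
    rw [paramPt_injective (MulAction.injective _ e)]
  · intro p hp
    simp only [mem_filter, mem_univ, true_and] at hp
    obtain ⟨hp, ⟨x, hx⟩, hf⟩ := hp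
    have hr : IsArc (ℙ F (Fin 3 → F)) ![p 0, p 2, p 4, x] := by
      have h1 := not_col_of_meet hp (by decide) (by decide) (by decide) (by decide) (by decide)
        hx.1 hx.2.1
      have h2 := not_col_of_meet hp (by decide) (by decide) (by decide) (by decide) (by decide)
        hx.1 hx.2.2
      have h3 := not_col_of_meet hp (by decide) (by decide) (by decide) (by decide) (by decide)
        hx.2.1 hx.2.2
      have h4 := hp.2 0 2 4 (by decide) (by decide) (by decide)
      rw [isArc_iff_lt (n := 1)]
      intro i j k
      fin_cases i <;> fin_cases j <;> fin_cases k <;> intro a b <;>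
        first
        | exact absurd a (by decide)
        | exact absurd b (by decide)
        | assumption
    have hg := fun i => congrFun (hG _ hr) i
    set g := G ![p 0, p 2, p 4, x]
    have hi : ∀ i, g⁻¹ • ![p 0, p 2, p 4, x] i = framePt F i := fun i =>
      inv_smul_eq_iff.2 (hg i).symm
    have hg' : g • framePt F 3 = x := hg 3
    obtain ⟨t, ht⟩ := eq_paramPt (p := g⁻¹ • p) ((isArc_smul _).2 hp)
      (hi 0) (hi 1) (hi 2) (by
        simp only [Pi.smul_apply]
        rw [← eq_inv_smul_iff] at hg'
        simpa only [hg', col_smul] using hx)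
    have ht' : g • paramPt t = p := by rw [ht, smul_inv_smul]
    refine ⟨(![p 0, p 2, p 4, x], t), ?_, ht'⟩
    simp only [mem_product, mem_filter, mem_univ, true_and]
    refine ⟨hr, (isArc_smul g).1 (ht' ▸ hp), (conc_smul g).1 ?_⟩
    have : g • (paramPt t ∘ f) = p ∘ f := by rw [← ht']; rfl
    rwa [this]

end Fibration

section Parameters

open Configuration Projectivization
open scoped LinearAlgebra.Projectivization

variable {F : Type*} [Field F]

/-- The pairs of parameters for which the first five points of `paramPt` form an arc. -/
def GoodPair (a b : F) : Prop := a ≠ 0 ∧ a ≠ 1 ∧ b ≠ 0 ∧ b ≠ 1 ∧ a * b ≠ 1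

/-- The triples of parameters for which `paramPt` is an arc. -/
def GoodTriple (a b c : F) : Prop :=
  GoodPair a b ∧ c ≠ 0 ∧ c ≠ 1 ∧ a * c ≠ 1 ∧ b * c ≠ 1 ∧ a * b * c - a - b - c + 2 ≠ 0

lemma GoodTriple.rotate {a b c : F} : GoodTriple a b c → GoodTriple b c a := by
  rintro ⟨⟨a0, a1, b0, b1, ab⟩, c0, c1, ac, bc, abc⟩
  exact ⟨⟨b0, b1, c0, c1, bc⟩, a0, a1, mul_comm a b ▸ ab, mul_comm a c ▸ ac,
    fun e => abc (by linear_combination e)⟩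

lemma isArc_paramPt_iff [DecidableEq F] {a b c : F} :
    IsArc (ℙ F (Fin 3 → F)) (paramPt (a, b, c)) ↔ GoodTriple a b c := by
  rw [isArc_iff_lt (n := 3)]
  simp only [col_paramPt, Matrix.det_fin_three]
  constructor
  · intro h
    have h1 := h 1 2 4 (by decide) (by decide)
    have h2 := h 1 2 5 (by decide) (by decide)
    have h3 := h 0 3 4 (by decide) (by decide)
    have h4 := h 0 3 5 (by decide) (by decide)
    have h5 := h 0 2 5 (by decide) (by decide)
    have h6 := h 1 3 5 (by decide) (by decide)
    have h7 := h 1 3 4 (by decide) (by decide)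
    have h8 := h 0 1 3 (by decide) (by decide)
    have h9 := h 1 4 5 (by decide) (by decide)
    have h10 := h 0 1 5 (by decide) (by decide)
    simp [paramVec] at h1 h2 h3 h4 h5 h6 h7 h8 h9 h10
    refine ⟨⟨h1, fun e => h9 ?_, h3, fun e => h8 ?_, fun e => h7 ?_⟩,
      h5, fun e => h10 ?_, fun e => h2 ?_, fun e => h4 ?_, fun e => h6 ?_⟩ <;>
      first | linear_combination e | linear_combination -e
  · rintro ⟨⟨a0, a1, b0, b1, ab⟩, c0, c1, ac, bc, abc⟩
    intro i j k hij hjk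
    fin_cases i <;> fin_cases j <;> first | exact absurd hij (by decide) | skip
    all_goals fin_cases k <;> first | exact absurd hjk (by decide) | skip
    all_goals simp [paramVec]
    all_goals intro e
    all_goals first
      | contradiction
      | exact a1 (by linear_combination e)
      | exact a1 (by linear_combination -e)
      | exact b1 (by linear_combination e)
      | exact b1 (by linear_combination -e)
      | exact c1 (by linear_combination e)
      | exact c1 (by linear_combination -e)
      | exact ab (by linear_combination e)
      | exact ac (by linear_combination e)
      | exact bc (by linear_combination e)
      | exact abc (by linear_combination e)

lemma conc_paramPt (t : F × F × F) : Conc (ℙ F (Fin 3 → F)) (paramPt t) := ⟨_, meet_paramPt t⟩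

lemma conc_paramPt_swap {a b c : F} :
    Conc (ℙ F (Fin 3 → F)) (paramPt (a, b, c) ∘ Equiv.swap (3 : Fin 6) 4) ↔ b + c = 2 := by
  have e : ∀ i, Equiv.swap (3 : Fin 6) 4 i = ![0, 1, 2, 4, 3, 5] i := by decide
  simp only [Conc, Function.comp_apply, e]
  constructor
  · rintro ⟨x, h1, h2, h3⟩
    induction x with | h x hx =>
    simp only [paramPt, col_mk_iff_det, Matrix.det_fin_three] at h1 h2 h3
    simp [paramVec] at h1 h2 h3
    have hx2 : x 2 ≠ 0 := fun h => hx <| by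
      funext i
      fin_cases i
      · exact h2
      · change x 1 = 0
        linear_combination h - h1
      · exact h
    refine mul_left_cancel₀ hx2 ?_
    linear_combination -h3 + (b * c - 1) * h2 + (c - 1) * h1
  · intro h
    have hx : (![0, 1, 1] : Fin 3 → F) ≠ 0 := by simp
    refine ⟨mk F _ hx, ?_, ?_, ?_⟩ <;>
      simp only [paramPt, col_mk_iff_det, Matrix.det_fin_three] <;> simp [paramVec]
    linear_combination -h

lemma conc_paramPt_rotate {a b c : F} :
    Conc (ℙ F (Fin 3 → F)) (paramPt (a, b, c) ∘ finRotate 6) ↔ a * b * c = 1 := by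
  have e : ∀ i, finRotate 6 i = ![1, 2, 3, 4, 5, 0] i := by decide
  simp only [Conc, Function.comp_apply, e]
  constructor
  · rintro ⟨x, h1, h2, h3⟩
    induction x with | h x hx =>
    simp only [paramPt, col_mk_iff_det, Matrix.det_fin_three] at h1 h2 h3
    simp [paramVec] at h1 h2 h3
    have hx2 : x 2 ≠ 0 := fun h => hx <| by
      have h0 : x 0 = 0 := by linear_combination a * h - h1
      funext i
      fin_cases i
      · exact h0
      · change x 1 = 0
        linear_combination b * h0 - h2
      · exact h
    refine mul_left_cancel₀ hx2 ?_
    linear_combination h3 + c * h2 + b * c * h1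
  · intro h
    have hx : (![a, a * b, 1] : Fin 3 → F) ≠ 0 := by simp
    refine ⟨mk F _ hx, ?_, ?_, ?_⟩ <;>
      simp only [paramPt, col_mk_iff_det, Matrix.det_fin_three] <;> simp [paramVec]
    · ring
    · linear_combination h

section Fibres

variable {α β : Type*} [Fintype α] [Fintype β]

lemma card_filter_notMem [DecidableEq α] (s : Finset α) :
    (#{x | x ∉ s} : ℤ) = Fintype.card α - #s := by
  rw [← compl_filter, filter_mem_eq_inter, univ_inter, card_compl, Nat.cast_sub (card_le_univ s)]

lemma card_filter_prod (P : α × β → Prop) [DecidablePred P] :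
    (#{x | P x} : ℤ) = ∑ a, (#{b | P (a, b)} : ℤ) := by
  simp only [card_filter, Fintype.sum_prod_type, Nat.cast_sum]

end Fibres

variable [Fintype F] [DecidableEq F]

instance (a b : F) : Decidable (GoodPair a b) := by unfold GoodPair; infer_instance

instance (a b c : F) : Decidable (GoodTriple a b c) := by unfold GoodTriple; infer_instance

lemma card_goodTriple_fibre {a b : F} (h : GoodPair a b) : (#{c | GoodTriple a b c} : ℤ) =
    Fintype.card F - 5 + (if a = b then 1 else 0) + (if a + b = 2 then 1 else 0) := by
  obtain ⟨a0, a1, b0, b1, ab⟩ := id h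
  have hab : a * b - 1 ≠ 0 := sub_ne_zero.2 ab
  set m := (a + b - 2) / (a * b - 1) with hm
  have e : ∀ c, GoodTriple a b c ↔ c ∉ ({1, m, 0, a⁻¹, b⁻¹} : Finset F) := by
    intro c
    have h1 : c = a⁻¹ ↔ a * c = 1 := by
      rw [← one_div, eq_div_iff a0, mul_comm]
    have h2 : c = b⁻¹ ↔ b * c = 1 := by
      rw [← one_div, eq_div_iff b0, mul_comm]
    have h3 : c = m ↔ a * b * c - a - b - c + 2 = 0 := by
      rw [hm, eq_div_iff hab]
      constructor <;> intro e <;> linear_combination e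
    simp only [GoodTriple, h, mem_insert, mem_singleton, h1, h2, h3]
    tauto
  have m1 : 1 ≠ m := by
    rw [hm, ne_comm, ne_eq, div_eq_one_iff_eq hab]
    intro e
    exact mul_ne_zero (sub_ne_zero.2 a1) (sub_ne_zero.2 b1) (by linear_combination -e)
  have ma : m ≠ a⁻¹ := by
    rw [hm, ne_comm, ne_eq, inv_eq_one_div, div_eq_div_iff a0 hab]
    intro e
    exact pow_ne_zero 2 (sub_ne_zero.2 a1) (by linear_combination -e)
  have mb : m ≠ b⁻¹ := by
    rw [hm, ne_comm, ne_eq, inv_eq_one_div, div_eq_div_iff b0 hab]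
    intro e
    exact pow_ne_zero 2 (sub_ne_zero.2 b1) (by linear_combination -e)
  have m0 : m = 0 ↔ a + b = 2 := by
    rw [hm, div_eq_zero_iff, or_iff_left hab, sub_eq_zero]
  have ha1 : 1 ≠ a⁻¹ := by simpa [eq_comm] using a1
  have hb1 : 1 ≠ b⁻¹ := by simpa [eq_comm] using b1
  have ha0 : 0 ≠ a⁻¹ := (inv_ne_zero a0).symm
  have hb0 : 0 ≠ b⁻¹ := (inv_ne_zero b0).symm
  simp only [e]
  rw [card_filter_notMem]
  simp only [card_insert_eq_ite, mem_insert, mem_singleton, m0, m1, ma, mb, ha1, hb1, ha0, hb0,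
    inv_inj, one_ne_zero, or_false, if_false, card_singleton]
  split_ifs <;> push_cast <;> ring

lemma card_goodTriple (p : F × F → Prop) [DecidablePred p] :
    (#{t : F × F × F | GoodTriple t.1 t.2.1 t.2.2 ∧ p (t.1, t.2.1)} : ℤ) =
      (Fintype.card F - 5) * #{x : F × F | GoodPair x.1 x.2 ∧ p x} +
        #{x : F × F | (GoodPair x.1 x.2 ∧ p x) ∧ x.1 = x.2} +
        #{x : F × F | (GoodPair x.1 x.2 ∧ p x) ∧ x.1 + x.2 = 2} := by
  have h : ∀ x : F × F, (#{c | GoodTriple x.1 x.2 c ∧ p x} : ℤ) =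
      if GoodPair x.1 x.2 ∧ p x then (Fintype.card F - 5 + (if x.1 = x.2 then 1 else 0) +
        (if x.1 + x.2 = 2 then 1 else 0) : ℤ) else 0 := by
    intro x
    by_cases hx : GoodPair x.1 x.2 ∧ p x
    · simp only [hx, and_true, card_goodTriple_fibre hx.1, if_true]
    · rw [if_neg hx, Nat.cast_eq_zero, card_eq_zero, filter_eq_empty_iff]
      exact fun c _ hc => hx ⟨hc.1.1, hc.2⟩
  rw [card_filter_prod]
  simp only [card_filter_prod (α := F) (β := F) fun y => GoodTriple _ y.1 y.2 ∧ p (_, y.1)]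
  rw [← Fintype.sum_prod_type' fun a b => (#{c | GoodTriple a b c ∧ p (a, b)} : ℤ)]
  simp only [h]
  rw [← sum_filter, sum_add_distrib, sum_add_distrib, sum_const, nsmul_eq_mul, sum_boole,
    sum_boole, filter_filter, filter_filter, mul_comm]

lemma card_goodPair :
    (#{x : F × F | GoodPair x.1 x.2} : ℤ) = (Fintype.card F - 2) * (Fintype.card F - 3) := by
  have h : ∀ a : F, (#{b | GoodPair a b} : ℤ) =
      if a ∉ ({0, 1} : Finset F) then (Fintype.card F - 3 : ℤ) else 0 := by
    intro a
    by_cases ha : a ∉ ({0, 1} : Finset F)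
    · rw [if_pos ha]
      simp only [mem_insert, mem_singleton, not_or] at ha
      have e : ∀ b, GoodPair a b ↔ b ∉ ({0, 1, a⁻¹} : Finset F) := by
        intro b
        have h1 : b = a⁻¹ ↔ a * b = 1 := by
          rw [← one_div, eq_div_iff ha.1, mul_comm]
        simp only [GoodPair, mem_insert, mem_singleton, h1]
        tauto
      simp only [e]
      rw [card_filter_notMem, card_eq_three.2 ⟨0, 1, a⁻¹, zero_ne_one, (inv_ne_zero ha.1).symm,
        by simpa [eq_comm] using ha.2, rfl⟩]
      rfl
    · rw [if_neg ha, Nat.cast_eq_zero, card_eq_zero, filter_eq_empty_iff]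
      intro b _ hb
      simp only [mem_insert, mem_singleton, not_or] at ha
      exact ha ⟨hb.1, hb.2.1⟩
  rw [card_filter_prod]
  simp only [h]
  rw [← sum_filter, sum_const, nsmul_eq_mul, card_filter_notMem, card_pair zero_ne_one]
  rfl

lemma card_goodPair_eq :
    (#{x : F × F | GoodPair x.1 x.2 ∧ x.1 = x.2} : ℤ) =
      Fintype.card F - 3 + if (2 : F) = 0 then 1 else 0 := by
  have h : #{x : F × F | GoodPair x.1 x.2 ∧ x.1 = x.2} = #{a | a ∉ ({0, 1, -1} : Finset F)} := by
    refine card_bij' (fun x _ => x.1) (fun a _ => (a, a)) ?_ ?_ ?_ ?_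
    · simp only [mem_filter_univ, mem_insert, mem_singleton, not_or]
      rintro ⟨a, b⟩ ⟨⟨a0, a1, _, _, ab⟩, h⟩
      refine ⟨a0, a1, fun e => ab ?_⟩
      simp only at e h ⊢
      rw [← h, e]
      ring
    · simp only [mem_filter_univ, mem_insert, mem_singleton, not_or]
      rintro a ⟨a0, a1, a2⟩
      refine ⟨⟨a0, a1, a0, a1, fun e => ?_⟩, by simp⟩
      rcases mul_self_eq_one_iff.1 e with e | e
      exacts [a1 e, a2 e]
    · simp only [mem_filter_univ]
      rintro ⟨a, b⟩ ⟨_, h⟩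
      exact Prod.ext rfl h
    · simp
  have h1 : (1 : F) = -1 ↔ (2 : F) = 0 := by
    rw [← sub_eq_zero, sub_neg_eq_add, one_add_one_eq_two]
  have h2 : ¬ (0 : F) = -1 := by simp [eq_comm]
  rw [h, card_filter_notMem]
  simp only [card_insert_eq_ite, mem_insert, mem_singleton, h1, h2, zero_ne_one, or_false, if_false,
    card_singleton]
  split_ifs <;> push_cast <;> ring

lemma card_goodPair_add :
    (#{x : F × F | GoodPair x.1 x.2 ∧ x.1 + x.2 = 2} : ℤ) =
      Fintype.card F - 3 + if (2 : F) = 0 then 1 else 0 := by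
  have h : #{x : F × F | GoodPair x.1 x.2 ∧ x.1 + x.2 = 2} =
      #{a | a ∉ ({1, 2, 0} : Finset F)} := by
    refine card_bij' (fun x _ => x.1) (fun a _ => (a, 2 - a)) ?_ ?_ ?_ ?_
    · simp only [mem_filter_univ, mem_insert, mem_singleton, not_or]
      rintro ⟨a, b⟩ ⟨⟨a0, a1, b0, b1, ab⟩, h⟩
      exact ⟨a1, fun e => b0 (by linear_combination h - e), a0⟩
    · simp only [mem_filter_univ, mem_insert, mem_singleton, not_or]
      rintro a ⟨a1, a2, a0⟩
      have a1' := sub_ne_zero.2 a1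
      exact ⟨⟨a0, a1, fun e => a2 (by linear_combination -e),
        fun e => a1 (by linear_combination -e),
        fun e => pow_ne_zero 2 a1' (by linear_combination -e)⟩, by ring⟩
    · simp only [mem_filter_univ]
      rintro ⟨a, b⟩ ⟨_, h⟩
      exact Prod.ext rfl (by linear_combination -h)
    · simp
  have h1 : ¬ (1 : F) = 2 := by
    intro e
    exact one_ne_zero (α := F) (by linear_combination -e)
  rw [h, card_filter_notMem]
  simp only [card_insert_eq_ite, mem_insert, mem_singleton, h1, one_ne_zero, or_false, if_false,
    card_singleton]
  split_ifs <;> push_cast <;> ring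

lemma card_goodPair_add_eq :
    (#{x : F × F | (GoodPair x.1 x.2 ∧ x.1 + x.2 = 2) ∧ x.1 = x.2} : ℤ) =
      (Fintype.card F - 2) * if (2 : F) = 0 then 1 else 0 := by
  split_ifs with h2
  · have h : #{x : F × F | (GoodPair x.1 x.2 ∧ x.1 + x.2 = 2) ∧ x.1 = x.2} =
        #{x : F × F | GoodPair x.1 x.2 ∧ x.1 = x.2} := by
      congr 1
      ext x
      simp only [mem_filter_univ]
      refine ⟨fun h => ⟨h.1.1, h.2⟩, fun h => ⟨⟨h.1, ?_⟩, h.2⟩⟩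
      linear_combination (x.2 - 1) * h2 + h.2
    rw [h, card_goodPair_eq, if_pos h2]
    ring
  · rw [mul_zero, Nat.cast_eq_zero, card_eq_zero, filter_eq_empty_iff]
    rintro x _ ⟨⟨h, h3⟩, h4⟩
    refine h.2.1 (mul_left_cancel₀ h2 ?_)
    linear_combination h3 + h4

lemma card_goodTriple_all : (#{t : F × F × F | GoodTriple t.1 t.2.1 t.2.2} : ℤ) =
    (Fintype.card F - 3) ^ 2 * (Fintype.card F - 4) + 2 * if (2 : F) = 0 then 1 else 0 := by
  have h := card_goodTriple (F := F) fun _ => True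
  simp only [and_true] at h
  rw [h, card_goodPair, card_goodPair_eq, card_goodPair_add]
  ring

lemma card_goodTriple_add :
    (#{t : F × F × F | GoodTriple t.1 t.2.1 t.2.2 ∧ t.2.1 + t.2.2 = 2} : ℤ) =
    (Fintype.card F - 3) * (Fintype.card F - 4) +
      2 * (Fintype.card F - 3) * if (2 : F) = 0 then 1 else 0 := by
  have h := card_goodTriple (F := F) fun x => x.1 + x.2 = 2
  have e : #{t : F × F × F | GoodTriple t.1 t.2.1 t.2.2 ∧ t.2.1 + t.2.2 = 2} =
      #{t : F × F × F | GoodTriple t.1 t.2.1 t.2.2 ∧ t.1 + t.2.1 = 2} := by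
    refine card_bij' (fun t _ => (t.2.1, t.2.2, t.1)) (fun t _ => (t.2.2, t.1, t.2.1)) ?_ ?_
      (fun _ _ => rfl) (fun _ _ => rfl)
    · simp only [mem_filter_univ]
      exact fun t ht => ⟨ht.1.rotate, ht.2⟩
    · simp only [mem_filter_univ]
      exact fun t ht => ⟨ht.1.rotate.rotate, ht.2⟩
  simp only [and_assoc, and_self] at h
  rw [e, h, card_goodPair_add]
  simp only [← and_assoc]
  rw [card_goodPair_add_eq]
  ring

lemma card_goodTriple_mul :
    (#{t : F × F × F | GoodTriple t.1 t.2.1 t.2.2 ∧ t.1 * t.2.1 * t.2.2 = 1} : ℤ) =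
    (Fintype.card F - 2) * (Fintype.card F - 4) + #{x : F | x ^ 2 + x + 1 = 0} := by
  have h1 : #{t : F × F × F | GoodTriple t.1 t.2.1 t.2.2 ∧ t.1 * t.2.1 * t.2.2 = 1} =
      #{x : F × F | GoodPair x.1 x.2 ∧ ¬ x.1 * x.2 * (x.1 + x.2 - 3) + 1 = 0} := by
    refine card_bij' (fun t _ => (t.1, t.2.1)) (fun x _ => (x.1, x.2, (x.1 * x.2)⁻¹)) ?_ ?_ ?_
      (fun _ _ => rfl)
    · simp only [mem_filter_univ]
      rintro ⟨a, b, c⟩ ⟨⟨h, c0, c1, ac, bc, abc⟩, e⟩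
      refine ⟨h, fun h' => abc ?_⟩
      refine mul_left_cancel₀ (mul_ne_zero h.1 h.2.2.1) ?_
      simp only at e h' ⊢
      linear_combination (a * b - 1) * e - h'
    · simp only [mem_filter_univ]
      rintro ⟨a, b⟩ ⟨⟨a0, a1, b0, b1, ab⟩, h⟩
      simp only at *
      have ab0 := mul_ne_zero a0 b0
      refine ⟨⟨⟨a0, a1, b0, b1, ab⟩, inv_ne_zero ab0, ?_, ?_, ?_, ?_⟩, mul_inv_cancel₀ ab0⟩
      · rwa [ne_eq, inv_eq_one]
      · intro h'
        field_simp at h'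
        exact b1 h'.symm
      · intro h'
        field_simp at h'
        exact a1 h'.symm
      · intro h'
        refine h ?_
        field_simp at h'
        linear_combination -h'
    · simp only [mem_filter_univ]
      rintro ⟨a, b, c⟩ ⟨_, h⟩
      simp only at h
      simp only [Prod.mk.injEq, true_and]
      exact inv_eq_of_mul_eq_one_right h
  have h2 : #{x : F × F | GoodPair x.1 x.2 ∧ x.1 * x.2 * (x.1 + x.2 - 3) + 1 = 0} =
      #{t : F | t ∉ ({0, -1} : Finset F) ∧ ¬ t ^ 2 + t + 1 = 0} := by
    refine card_bij' (fun x _ => (x.2 - 1) / (x.1 - 1))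
      (fun t _ => (-1 / (t * (1 + t)), -t ^ 2 / (1 + t))) ?_ ?_ ?_ ?_
    · simp only [mem_filter_univ, mem_insert, mem_singleton, not_or]
      rintro ⟨a, b⟩ ⟨⟨a0, a1, b0, b1, ab⟩, h⟩
      simp only at *
      have ha := sub_ne_zero.2 a1
      have hs : a + b - 2 ≠ 0 := fun e => ab (by linear_combination a * b * e - h)
      refine ⟨⟨div_ne_zero (sub_ne_zero.2 b1) ha, fun e => hs ?_⟩, fun e => hs ?_⟩
      · rw [div_eq_iff ha] at e
        linear_combination e
      · field_simp at e
        refine pow_eq_zero_iff (three_ne_zero) |>.1 ?_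
        linear_combination (a + b - 3) * e + h
    · simp only [mem_filter_univ, mem_insert, mem_singleton, not_or]
      rintro t ⟨⟨t0, t1⟩, ht⟩
      have t1' : 1 + t ≠ 0 := fun e => t1 (by linear_combination e)
      refine ⟨⟨?_, ?_, ?_, ?_, ?_⟩, ?_⟩
      · exact div_ne_zero (neg_ne_zero.2 one_ne_zero) (mul_ne_zero t0 t1')
      · rw [ne_eq, div_eq_one_iff_eq (mul_ne_zero t0 t1')]
        exact fun e => ht (by linear_combination -e)
      · exact div_ne_zero (neg_ne_zero.2 (pow_ne_zero 2 t0)) t1'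
      · rw [ne_eq, div_eq_one_iff_eq t1']
        exact fun e => ht (by linear_combination -e)
      · intro e
        field_simp at e
        exact ht (by linear_combination -e)
      · field_simp
        ring
    · simp only [mem_filter_univ]
      rintro ⟨a, b⟩ ⟨⟨a0, a1, b0, b1, ab⟩, h⟩
      simp only at *
      have ha := sub_ne_zero.2 a1
      have hb := sub_ne_zero.2 b1
      have hs : a + b - 2 ≠ 0 := fun e => ab (by linear_combination a * b * e - h)
      have e : 1 + (b - 1) / (a - 1) = (a + b - 2) / (a - 1) := by
        field_simp
        ring
      rw [e]
      ext
      · simp only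
        field_simp
        linear_combination -h
      · simp only
        field_simp
        linear_combination -h
    · simp only [mem_filter_univ, mem_insert, mem_singleton, not_or]
      rintro t ⟨⟨t0, t1⟩, ht⟩
      have t1' : 1 + t ≠ 0 := fun e => t1 (by linear_combination e)
      have e1 : -1 / (t * (1 + t)) - 1 = -(t ^ 2 + t + 1) / (t * (1 + t)) := by
        field_simp
        ring
      have e2 : -t ^ 2 / (1 + t) - 1 = -(t ^ 2 + t + 1) / (1 + t) := by
        field_simp
        ring
      rw [e1, e2]
      field_simp
      exact div_self fun e => ht (by linear_combination e)
  have h3 : #{t : F | t ∉ ({0, -1} : Finset F) ∧ t ^ 2 + t + 1 = 0} =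
      #{t : F | t ^ 2 + t + 1 = 0} := by
    congr 1
    ext t
    simp only [mem_filter_univ, and_iff_right_iff_imp, mem_insert, mem_singleton]
    rintro h (rfl | rfl) <;> simp at h
  have h4 := card_filter_add_card_filter_not (s := {t : F | t ∉ ({0, -1} : Finset F)})
    fun t => t ^ 2 + t + 1 = 0
  have h5 := card_filter_add_card_filter_not (s := {x : F × F | GoodPair x.1 x.2})
    fun x => x.1 * x.2 * (x.1 + x.2 - 3) + 1 = 0
  rw [filter_filter, filter_filter] at h4 h5
  have h6 := card_filter_notMem ({0, -1} : Finset F)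
  rw [card_pair (by simp [eq_comm])] at h6
  have h7 := card_goodPair (F := F)
  rw [h1]
  rw [h2] at h5
  rw [h3] at h4
  push_cast at h6
  zify at h4 h5
  linear_combination h5 - h4 + h7 - h6

end Parameters

section Counts

open Configuration Projectivization
open scoped LinearAlgebra.Projectivization

variable {F : Type*} [Field F] [Fintype F] [DecidableEq F]

lemma order_eq_card :
    ProjectivePlane.order (ℙ F (Fin 3 → F)) (ℙ F (Fin 3 → F)) = Fintype.card F := by
  have := Fintype.ofFinite (ℙ F (Fin 3 → F))
  have h := ProjectivePlane.card_points (ℙ F (Fin 3 → F)) (ℙ F (Fin 3 → F))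
  rw [← Nat.card_eq_fintype_card, card_of_finrank F (Fin 3 → F) (Module.finrank_fin_fun F),
    Nat.card_eq_fintype_card] at h
  simp only [sum_range_succ, range_zero, sum_empty, pow_zero, pow_one] at h
  have h' : ProjectivePlane.order (ℙ F (Fin 3 → F)) (ℙ F (Fin 3 → F)) *
      (ProjectivePlane.order (ℙ F (Fin 3 → F)) (ℙ F (Fin 3 → F)) + 1) =
      Fintype.card F * (Fintype.card F + 1) := by linarith
  nlinarith [h']

lemma two_dvd_card_iff (F : Type*) [Field F] [Fintype F] :
    2 ∣ Fintype.card F ↔ (2 : F) = 0 := by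
  rw [Nat.dvd_iff_mod_eq_zero, ← FiniteField.even_card_iff_char_two]
  exact ⟨fun h => by simpa [h] using ringChar.Nat.cast_ringChar (R := F),
    fun h => by_contra fun h' => Ring.two_ne_zero h' h⟩

variable [Fintype (ℙ F (Fin 3 → F))]

lemma concArcCount_eq :
    (concArcCount (ℙ F (Fin 3 → F)) (ℙ F (Fin 3 → F)) : ℤ) =
      arcCount (ℙ F (Fin 3 → F)) (ℙ F (Fin 3 → F)) 4 *
        ((Fintype.card F - 3) ^ 2 * (Fintype.card F - 4) + 2 * if (2 : F) = 0 then 1 else 0) := by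
  have h := biconcCount_eq_mul (F := F) 1
  have e : biconcCount (ℙ F (Fin 3 → F)) (ℙ F (Fin 3 → F)) 1 =
      concArcCount (ℙ F (Fin 3 → F)) (ℙ F (Fin 3 → F)) := by
    rw [biconcCount, concArcCount]
    congr 1
    ext p
    simp only [mem_filter_univ]
    rw [Equiv.Perm.coe_one, Function.comp_id, and_self]
  rw [← e, h, Nat.cast_mul, ← card_goodTriple_all]
  congr 3
  ext ⟨a, b, c⟩
  simp only [mem_filter_univ]
  rw [isArc_paramPt_iff, Equiv.Perm.coe_one, Function.comp_id]
  exact and_iff_left (conc_paramPt _)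

lemma biconcCount_swap_eq :
    (biconcCount (ℙ F (Fin 3 → F)) (ℙ F (Fin 3 → F)) (Equiv.swap 3 4) : ℤ) =
      arcCount (ℙ F (Fin 3 → F)) (ℙ F (Fin 3 → F)) 4 *
        ((Fintype.card F - 3) * (Fintype.card F - 4) +
          2 * (Fintype.card F - 3) * if (2 : F) = 0 then 1 else 0) := by
  rw [biconcCount_eq_mul, Nat.cast_mul, ← card_goodTriple_add]
  congr 3
  ext ⟨a, b, c⟩
  simp only [mem_filter_univ]
  rw [conc_paramPt_swap, isArc_paramPt_iff]

lemma biconcCount_finRotate_eq :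
    (biconcCount (ℙ F (Fin 3 → F)) (ℙ F (Fin 3 → F)) (finRotate 6) : ℤ) =
      arcCount (ℙ F (Fin 3 → F)) (ℙ F (Fin 3 → F)) 4 *
        ((Fintype.card F - 2) * (Fintype.card F - 4) + #{x : F | x ^ 2 + x + 1 = 0}) := by
  rw [biconcCount_eq_mul, Nat.cast_mul, ← card_goodTriple_mul]
  congr 3
  ext ⟨a, b, c⟩
  simp only [mem_filter_univ]
  rw [conc_paramPt_rotate, isArc_paramPt_iff]

end Counts

open Projectivization in
lemma p2Collinear_iff {F : Type} [Field F] [DecidableEq F]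
    {x y z : Projectivization F (Fin 3 → F)} :
    P2Collinear F x y z ↔ Col (Projectivization F (Fin 3 → F)) x y z := by
  rw [P2Collinear, independent_iff, col_iff_rep]
  congr! 2
  ext i : 1
  fin_cases i <;> rfl

lemma p2nArcs_eq (F : Type) [Field F] [DecidableEq F] [Fintype (Projectivization F (Fin 3 → F))]
    (n : ℕ) : P2nArcs F n =
      arcCount (Projectivization F (Fin 3 → F)) (Projectivization F (Fin 3 → F)) n := by
  classical
  rw [P2nArcs, Nat.card_eq_fintype_card, Fintype.card_subtype, arcCount]
  congr 1
  ext p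
  simp only [mem_filter_univ]
  rw [IsArc]
  simp only [p2Collinear_iff]

end PlaneArcs

/-- The quasipolynomial formula for the number of ordered 8-arcs in `ℙ²(F_q)`,
where `a(q) = 1` if `q` is even and `0` otherwise, and
`b(q) = #{x ∈ F_q : x² + x + 1 = 0}`. -/
theorem count_eight_arcs_desarguesian (F : Type) [Field F] [Fintype F]
    (q a b : ℤ) (hq : q = Fintype.card F)
    (ha : a = if 2 ∣ Fintype.card F then 1 else 0)
    (hb : b = Nat.card {x : F // x ^ 2 + x + 1 = 0}) :
    (P2nArcs F 8 : ℤ) =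
      (q ^ 2 + q + 1) * (q ^ 2 + q) * q ^ 2 * (q - 1) ^ 2 *
        ((q - 5) * (q ^ 7 - 43 * q ^ 6 + 788 * q ^ 5 - 7937 * q ^ 4
            + 47097 * q ^ 3 - 162834 * q ^ 2 + 299280 * q - 222960)
          - 240 * (q ^ 2 - 20 * q + 78) * a + 840 * b) := by
  classical
  have := Fintype.ofFinite (Projectivization F (Fin 3 → F))
  obtain ⟨h4, h8⟩ := PlaneArcs.arcCount_four_eight (P := Projectivization F (Fin 3 → F))
    (L := Projectivization F (Fin 3 → F)) (q := q) (by rw [PlaneArcs.order_eq_card, hq])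
  rw [Nat.card_eq_fintype_card, Fintype.card_subtype] at hb
  simp only [PlaneArcs.two_dvd_card_iff] at ha
  rw [PlaneArcs.concArcCount_eq, PlaneArcs.biconcCount_swap_eq,
    PlaneArcs.biconcCount_finRotate_eq, ← hq, ← ha, ← hb, h4] at h8
  rw [PlaneArcs.p2nArcs_eq, h8]
  ring
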